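/- arXiv:1605.06577 — 2 statements merged into one kernel-verified Lean document; each statement's English description precedes it below -/
import Mathlib

section
/- Let s ≥ r ≥ 2 be fixed positive integers, let A be a pattern with r classes on the positions of an m'×n' array (i.e., a partition of [m']×[n'] into r nonempty parts), and let b₁, b₂ > 0 be fixed constants. Then f(m,n; s, A) = (1+o(1))·((s−r+1)/s)·mn as m+n → ∞ subject to b₁ ≤ m/n ≤ b₂. Precisely: for every ε > 0 there exists N such that for all m, n with m+n ≥ N and b₁ ≤ m/n ≤ b₂, one has (1−ε)·((s−r+1)/s)·mn ≤ f(m,n; s, A) ≤ ((s−r+1)/s)·mn. -/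
open Finset

/-- An `m × n` matrix `M` contains a submatrix (given by distinct row indices `φ` and distinct
column indices `ψ`) whose equality pattern of entries is exactly the partition pattern `P`
(a surjective labeling of positions of an `m' × n'` array by `r` classes). -/
def HasSubpattern {m n m' n' r : ℕ} {α : Type*} (M : Fin m → Fin n → α)
    (P : Fin m' × Fin n' → Fin r) : Prop :=
  ∃ φ : Fin m' ↪ Fin m, ∃ ψ : Fin n' ↪ Fin n,
    ∀ i i' : Fin m', ∀ j j' : Fin n',
      (M (φ i) (ψ j) = M (φ i') (ψ j') ↔ P (i, j) = P (i', j'))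

/-- The Hamming distance between two matrices: the number of positions where they differ. -/
def MatDist {m n : ℕ} {α : Type*} [DecidableEq α] (M M' : Fin m → Fin n → α) : ℕ :=
  (univ.filter fun p : Fin m × Fin n => M p.1 p.2 ≠ M' p.1 p.2).card

lemma card_filter_product_eq_sum {A B : Type*} (X : Finset A) (Y : Finset B)
    (p : A → B → Prop) [∀ x y, Decidable (p x y)] :
    #{q ∈ X ×ˢ Y | p q.1 q.2} = ∑ x ∈ X, #{y ∈ Y | p x y} := by
  simp only [Finset.card_filter, Finset.sum_product]

/-- If every colour `Q i j` is dense in all large subrectangles of `X ×ˢ Y`, then rows realizing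
the array `Q` can be chosen greedily, keeping for each column a large set of candidates. -/
lemma exists_rows_of_dense {A B ι κ σ : Type*} [DecidableEq A] [DecidableEq ι]
    [DecidableEq σ] [Fintype κ] (F : A → B → σ) (X : Finset A) (Y : Finset B)
    (Q : ι → κ → σ) (η γ : ℝ) (hη : 0 < η) (hη1 : η ≤ 1) (hκ : Fintype.card κ * γ ≤ 1 / 2)
    (hden : ∀ X' ⊆ X, ∀ Y' ⊆ Y, γ * #X ≤ #X' → γ * #Y ≤ #Y' → ∀ i j,
      η * (#X' * #Y') < #{q ∈ X' ×ˢ Y' | F q.1 q.2 = Q i j})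
    (T : Finset ι) (hT : γ ≤ η ^ #T) (hX : 2 * #T < #X) :
    ∃ φ : ι → A, ∃ Z : κ → Finset B, Set.InjOn φ T ∧ (∀ j, Z j ⊆ Y) ∧
      (∀ j, η ^ #T * #Y ≤ #(Z j)) ∧ ∀ i ∈ T, ∀ j, ∀ y ∈ Z j, F (φ i) y = Q i j := by
  induction T using Finset.induction_on with
  | empty =>
    obtain ⟨x, -⟩ : X.Nonempty := card_pos.1 (by omega)
    exact ⟨fun _ => x, fun _ => Y, by simp, by simp, by simp, by simp⟩
  | insert i T hi ih =>
    rw [card_insert_of_notMem hi] at hT hX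
    have hpow : η ^ (#T + 1) ≤ η ^ #T := pow_le_pow_of_le_one hη.le hη1 (by omega)
    obtain ⟨φ, Z, hinj, hZY, hZ, hφ⟩ := ih (hT.trans hpow) (by omega)
    let bad : κ → Finset A := fun j => {x ∈ X | (#{y ∈ Z j | F x y = Q i j} : ℝ) ≤ η * #(Z j)}
    have hbad : ∀ j, (#(bad j) : ℝ) ≤ γ * #X := by
      intro j
      by_contra! h
      have h1 := hden (bad j) (filter_subset _ _) (Z j) (hZY j) h.le
        ((mul_le_mul_of_nonneg_right (hT.trans hpow) (by positivity)).trans (hZ j)) i j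
      rw [card_filter_product_eq_sum (bad j) (Z j) (fun x y => F x y = Q i j)] at h1
      have h2 : ∑ x ∈ bad j, (#{y ∈ Z j | F x y = Q i j} : ℝ) ≤ #(bad j) • (η * #(Z j)) :=
        sum_le_card_nsmul _ _ _ fun x hx => (mem_filter.1 hx).2
      push_cast at h1
      rw [nsmul_eq_mul] at h2
      linarith
    obtain ⟨x, hxX, hx⟩ : ∃ x ∈ X, x ∉ univ.biUnion bad ∪ T.image φ := by
      apply exists_mem_notMem_of_card_lt_card
      have h1 : (#(univ.biUnion bad) : ℝ) ≤ Fintype.card κ * (γ * #X) := by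
        calc (#(univ.biUnion bad) : ℝ) ≤ ∑ j, (#(bad j) : ℝ) := by
              exact_mod_cast card_biUnion_le
          _ ≤ ∑ _j : κ, γ * #X := sum_le_sum fun j _ => hbad j
          _ = _ := by simp
      have h2 : (#(T.image φ) : ℝ) ≤ #T := by exact_mod_cast card_image_le
      have h3 : (#(univ.biUnion bad ∪ T.image φ) : ℝ) ≤ #(univ.biUnion bad) + #(T.image φ) := by
        exact_mod_cast card_union_le _ _
      have h4 : 2 * ((#T : ℝ) + 1) < #X := by exact_mod_cast hX
      have h5 := mul_le_mul_of_nonneg_right hκ (Nat.cast_nonneg (α := ℝ) #X)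
      have : (#(univ.biUnion bad ∪ T.image φ) : ℝ) < #X := by linarith
      exact_mod_cast this
    simp only [mem_union, mem_biUnion, mem_univ, true_and, mem_image, not_or, not_exists,
      not_and] at hx
    have hne : ∀ k ∈ T, k ≠ i := fun k hk h => hi (h ▸ hk)
    refine ⟨Function.update φ i x, fun j => {y ∈ Z j | F x y = Q i j}, ?_, ?_, ?_, ?_⟩
    · intro k hk l hl hkl
      simp only [coe_insert, Set.mem_insert_iff, mem_coe] at hk hl
      rcases hk with rfl | hk <;> rcases hl with rfl | hl
      · rfl
      · rw [Function.update_self, Function.update_of_ne (hne l hl)] at hkl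
        exact absurd hkl.symm (hx.2 l hl)
      · rw [Function.update_self, Function.update_of_ne (hne k hk)] at hkl
        exact absurd hkl (hx.2 k hk)
      · rw [Function.update_of_ne (hne k hk), Function.update_of_ne (hne l hl)] at hkl
        exact hinj hk hl hkl
    · exact fun j => (filter_subset _ _).trans (hZY j)
    · intro j
      have h1 : η * #(Z j) < #{y ∈ Z j | F x y = Q i j} := by
        by_contra! h
        exact hx.1 j (mem_filter.2 ⟨hxX, h⟩)
      rw [card_insert_of_notMem hi, pow_succ']
      nlinarith [mul_le_mul_of_nonneg_left (hZ j) hη.le]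
    · intro k hk j y hy
      rw [mem_filter] at hy
      rcases mem_insert.1 hk with rfl | hk
      · rw [Function.update_self]; exact hy.2
      · rw [Function.update_of_ne (hne k hk)]; exact hφ k hk j y hy.1

/-- In a large rectangle of a matrix avoiding `P`, among any `r` colours one is sparse in some
subrectangle of proportional size. -/
lemma exists_sparse_colour {s r m' n' : ℕ} (P : Fin m' × Fin n' → Fin r) (η : ℝ) (hη : 0 < η)
    (hη1 : η ≤ 1) :
    ∃ γ : ℝ, 0 < γ ∧ ∃ N : ℕ, ∀ (m n : ℕ) (F : Fin m → Fin n → Fin s),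
      ¬ HasSubpattern F P → ∀ X Y, N ≤ #X → N ≤ #Y → ∀ ρ : Fin r ↪ Fin s,
      ∃ k, ∃ X' ⊆ X, ∃ Y' ⊆ Y, γ * #X ≤ #X' ∧ γ * #Y ≤ #Y' ∧
        (#{q ∈ X' ×ˢ Y' | F q.1 q.2 = ρ k} : ℝ) ≤ η * (#X' * #Y') := by
  have hγ : 0 < min (η ^ m') (1 / (2 * ((n' : ℝ) + 1))) := by positivity
  have hγ1 := min_le_left (η ^ m') (1 / (2 * ((n' : ℝ) + 1)))
  have hγ2 := min_le_right (η ^ m') (1 / (2 * ((n' : ℝ) + 1)))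
  set γ := min (η ^ m') (1 / (2 * ((n' : ℝ) + 1)))
  refine ⟨γ, hγ, 2 * m' + 1 + ⌈n' / γ⌉₊, fun m n F hF X Y hX hY ρ => ?_⟩
  by_contra! hcon
  obtain ⟨φ, Z, hinj, hZY, hZ, hφ⟩ := exists_rows_of_dense F X Y (fun i j => ρ (P (i, j))) η γ
    hη hη1 (by
      rw [Fintype.card_fin]
      rw [le_div_iff₀ (by positivity)] at hγ2
      nlinarith) (fun X' hX' Y' hY' h1 h2 i j => hcon _ X' hX' Y' hY' h1 h2) (univ : Finset (Fin m'))
      (by simpa using hγ1) (by simp; omega)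
  have hZn : ∀ j, n' ≤ #(Z j) := by
    intro j
    have h1 : (n' : ℝ) / γ ≤ #Y := (Nat.le_ceil _).trans (by exact_mod_cast (by omega))
    rw [div_le_iff₀ hγ] at h1
    have h2 := hZ j
    rw [card_univ, Fintype.card_fin] at h2
    have h3 := mul_le_mul_of_nonneg_right hγ1 (Nat.cast_nonneg (α := ℝ) #Y)
    have : (n' : ℝ) ≤ #(Z j) := by linarith
    exact_mod_cast this
  obtain ⟨ψ, hψ, hψZ⟩ := (Finset.all_card_le_biUnion_card_iff_exists_injective Z).1 (by
    intro S
    rcases S.eq_empty_or_nonempty with rfl | ⟨j, hj⟩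
    · simp
    · have hS : #S ≤ n' := by simpa using card_le_univ S
      exact (hS.trans (hZn j)).trans (card_le_card (subset_biUnion_of_mem Z hj)))
  rw [coe_univ, Set.injOn_univ] at hinj
  refine hF ⟨⟨φ, hinj⟩, ⟨ψ, hψ⟩, fun i i' j j' => ?_⟩
  simp only [Function.Embedding.coeFn_mk]
  rw [hφ i (mem_univ _) j _ (hψZ j), hφ i' (mem_univ _) j' _ (hψZ j'), ρ.injective.eq_iff]

/-- In a large rectangle of a matrix avoiding `P`, some subrectangle of proportional size has `k`
colours of small total density, as long as `k ≤ s - r + 1`. -/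
lemma exists_sparse_colours {s r m' n' : ℕ} (P : Fin m' × Fin n' → Fin r) (k : ℕ)
    (hk : k + r ≤ s + 1) (ε : ℝ) (hε : 0 < ε) (hε1 : ε ≤ 1) :
    ∃ γ : ℝ, 0 < γ ∧ ∃ N : ℕ, ∀ (m n : ℕ) (F : Fin m → Fin n → Fin s),
      ¬ HasSubpattern F P → ∀ X Y, N ≤ #X → N ≤ #Y →
      ∃ D : Finset (Fin s), #D = k ∧ ∃ X' ⊆ X, ∃ Y' ⊆ Y, γ * #X ≤ #X' ∧ γ * #Y ≤ #Y' ∧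
        (#{q ∈ X' ×ˢ Y' | F q.1 q.2 ∈ D} : ℝ) ≤ ε * (#X' * #Y') := by
  induction k generalizing ε with
  | zero =>
    refine ⟨1, one_pos, 0, fun m n F _ X Y _ _ => ⟨∅, rfl, X, subset_rfl, Y, subset_rfl, ?_⟩⟩
    simp
    positivity
  | succ k ih =>
    obtain ⟨γ, hγ, N, h⟩ := exists_sparse_colour (s := s) P (ε / 2) (by positivity) (by linarith)
    obtain ⟨γ', hγ', N', h'⟩ := ih (by omega) (min 1 (γ ^ 2 * (ε / 2))) (by positivity)
      (min_le_left _ _)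
    refine ⟨γ * γ', by positivity, N' + ⌈N / γ'⌉₊, fun m n F hF X Y hX hY => ?_⟩
    obtain ⟨D, hD, X₁, hX₁, Y₁, hY₁, hXc, hYc, hcount⟩ :=
      h' m n F hF X Y (by omega) (by omega)
    have hlarge : ∀ a b : ℕ, N' + ⌈N / γ'⌉₊ ≤ a → γ' * a ≤ b → N ≤ b := by
      intro a b ha hb
      have h1 : (N : ℝ) / γ' ≤ a := (Nat.le_ceil _).trans (by exact_mod_cast (by omega))
      rw [div_le_iff₀ hγ'] at h1
      exact_mod_cast (by linarith : (N : ℝ) ≤ b)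
    obtain ⟨R, hRD, hR⟩ := exists_subset_card_eq (s := Dᶜ) (n := r)
      (by rw [card_compl, Fintype.card_fin]; omega)
    obtain ⟨c, X₂, hX₂, Y₂, hY₂, hXc₂, hYc₂, hcount₂⟩ := h m n F hF X₁ Y₁
      (hlarge _ _ hX hXc) (hlarge _ _ hY hYc) (R.orderEmbOfFin hR).toEmbedding
    have hcD : R.orderEmbOfFin hR c ∉ D := mem_compl.1 (hRD (orderEmbOfFin_mem R hR c))
    refine ⟨insert (R.orderEmbOfFin hR c) D, by rw [card_insert_of_notMem hcD, hD], X₂,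
      hX₂.trans hX₁, Y₂, hY₂.trans hY₁, ?_, ?_, ?_⟩
    · rw [mul_assoc]
      exact (mul_le_mul_of_nonneg_left hXc hγ.le).trans hXc₂
    · rw [mul_assoc]
      exact (mul_le_mul_of_nonneg_left hYc hγ.le).trans hYc₂
    · have h1 : (#{q ∈ X₂ ×ˢ Y₂ | F q.1 q.2 ∈ insert (R.orderEmbOfFin hR c) D} : ℝ) ≤
          #{q ∈ X₂ ×ˢ Y₂ | F q.1 q.2 = R.orderEmbOfFin hR c} +
          #{q ∈ X₁ ×ˢ Y₁ | F q.1 q.2 ∈ D} := by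
        simp only [mem_insert, filter_or]
        refine le_trans (Nat.cast_le.2 (card_union_le _ _)) ?_
        push_cast
        gcongr
      have h2 : (γ * #X₁) * (γ * #Y₁) ≤ #X₂ * #Y₂ := by gcongr
      have h3 : min 1 (γ ^ 2 * (ε / 2)) * (#X₁ * #Y₁ : ℝ) ≤ γ ^ 2 * (ε / 2) * (#X₁ * #Y₁) := by
        gcongr
        exact min_le_right _ _
      have h4 := mul_le_mul_of_nonneg_left h2 (by positivity : 0 ≤ ε / 2)
      simp only [RelEmbedding.coe_toEmbedding] at hcount₂
      nlinarith

/-- If the colours of `M` are evenly distributed on rectangles, then a matrix avoiding `P`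
agrees with `M` on little more than a proportion `(r - 1) / s` of any rectangle. -/
lemma card_agree_le {s r m' n' : ℕ} (hr : 1 ≤ r) (hrs : r ≤ s) (P : Fin m' × Fin n' → Fin r)
    (ε : ℝ) (hε : 0 < ε) (hε1 : ε ≤ 1) :
    ∃ γ : ℝ, 0 < γ ∧ γ ≤ 1 ∧ ∃ N : ℕ, ∀ (m n : ℕ) (F M : Fin m → Fin n → Fin s) (Δ : ℝ), 0 ≤ Δ →
      ¬ HasSubpattern F P →
      (∀ X Y c, (#{q ∈ X ×ˢ Y | M q.1 q.2 = c} : ℝ) ≤ #X * #Y / s + Δ) →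
      ∀ (t : ℕ) (X : Finset (Fin m)) (Y : Finset (Fin n)),
        (#{q ∈ X ×ˢ Y | M q.1 q.2 = F q.1 q.2} : ℝ) ≤
          (((r : ℝ) - 1) / s + ε) * (#X * #Y) + (1 - γ ^ 2) ^ t * (#X * #Y)
            + 3 ^ t * (s * Δ + N * (m + n)) := by
  obtain ⟨γ₀, hγ₀, N, h⟩ := exists_sparse_colours (s := s) P (s - r + 1) (by omega) ε hε hε1
  have hγ : 0 < min 1 γ₀ := by positivity
  have hγ1 := min_le_left 1 γ₀
  have hγ2 := min_le_right 1 γ₀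
  set γ := min 1 γ₀
  have hs : (0 : ℝ) < s := by exact_mod_cast (by omega : 0 < s)
  have hr' : (0 : ℝ) ≤ (r : ℝ) - 1 := by simpa using (by exact_mod_cast hr : (1 : ℝ) ≤ r)
  refine ⟨γ, hγ, hγ1, N, fun m n F M Δ hΔ hF hM t => ?_⟩
  have hE : 0 ≤ s * Δ + N * ((m : ℝ) + n) := by positivity
  have hθ : 0 ≤ ((r : ℝ) - 1) / s + ε := by positivity
  have hγ3 : 0 ≤ 1 - γ ^ 2 := by nlinarith
  have htriv : ∀ (X : Finset (Fin m)) (Y : Finset (Fin n)),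
      (#{q ∈ X ×ˢ Y | M q.1 q.2 = F q.1 q.2} : ℝ) ≤ #X * #Y := by
    intro X Y
    rw [← Nat.cast_mul, ← card_product]
    exact_mod_cast card_filter_le _ _
  induction t with
  | zero =>
    intro X Y
    have := htriv X Y
    have h2 : 0 ≤ (((r : ℝ) - 1) / s + ε) * (#X * #Y) := by positivity
    simp only [pow_zero, one_mul]
    linarith
  | succ t ih =>
    intro X Y
    have h3t : (1 : ℝ) ≤ 3 ^ t := one_le_pow₀ (by norm_num)
    have hXm : (#X : ℝ) ≤ m := by exact_mod_cast (card_le_univ X).trans (by simp)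
    have hYn : (#Y : ℝ) ≤ n := by exact_mod_cast (card_le_univ Y).trans (by simp)
    by_cases hsmall : N ≤ #X ∧ N ≤ #Y
    · obtain ⟨D, hD, X', hX', Y', hY', hXc, hYc, hc⟩ := h m n F hF X Y hsmall.1 hsmall.2
      have hsplit : (#{q ∈ X ×ˢ Y | M q.1 q.2 = F q.1 q.2} : ℝ) =
          #{q ∈ X' ×ˢ Y' | M q.1 q.2 = F q.1 q.2} + #{q ∈ X' ×ˢ (Y \ Y') | M q.1 q.2 = F q.1 q.2}
            + #{q ∈ (X \ X') ×ˢ Y | M q.1 q.2 = F q.1 q.2} := by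
        simp only [card_filter_product_eq_sum _ _ fun x y => M x y = F x y]
        rw [← sum_sdiff hX', add_comm, ← Nat.cast_add, ← sum_add_distrib, Nat.cast_add]
        congr 2
        refine sum_congr rfl fun x _ => ?_
        simp only [card_filter]
        rw [← sum_sdiff hY', add_comm]
      have hgood : (#{q ∈ X' ×ˢ Y' | M q.1 q.2 = F q.1 q.2} : ℝ) ≤
          (((r : ℝ) - 1) / s + ε) * (#X' * #Y') + s * Δ := by
        have h1 : ({q ∈ X' ×ˢ Y' | M q.1 q.2 = F q.1 q.2} : Finset _) ⊆
            Dᶜ.biUnion (fun c => {q ∈ X' ×ˢ Y' | M q.1 q.2 = c}) ∪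
              {q ∈ X' ×ˢ Y' | F q.1 q.2 ∈ D} := by
          intro q hq
          rw [mem_filter] at hq
          by_cases hqD : F q.1 q.2 ∈ D
          · exact mem_union_right _ (mem_filter.2 ⟨hq.1, hqD⟩)
          · exact mem_union_left _ (mem_biUnion.2
              ⟨_, mem_compl.2 hqD, mem_filter.2 hq⟩)
        have h2 : (#(Dᶜ.biUnion (fun c => {q ∈ X' ×ˢ Y' | M q.1 q.2 = c})) : ℝ) ≤
            #Dᶜ * (#X' * #Y' / s + Δ) := by
          calc _ ≤ ∑ c ∈ Dᶜ, (#{q ∈ X' ×ˢ Y' | M q.1 q.2 = c} : ℝ) := by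
                exact_mod_cast card_biUnion_le
            _ ≤ ∑ _c ∈ Dᶜ, ((#X' : ℝ) * #Y' / s + Δ) := sum_le_sum fun c _ => hM X' Y' c
            _ = _ := by rw [sum_const, nsmul_eq_mul]
        have h3 : (#Dᶜ : ℝ) = (r : ℝ) - 1 := by
          rw [card_compl, Fintype.card_fin, hD, eq_sub_iff_add_eq]
          exact_mod_cast (by omega)
        have h4 : (#{q ∈ X' ×ˢ Y' | M q.1 q.2 = F q.1 q.2} : ℝ) ≤
            #(Dᶜ.biUnion (fun c => {q ∈ X' ×ˢ Y' | M q.1 q.2 = c})) +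
              #{q ∈ X' ×ˢ Y' | F q.1 q.2 ∈ D} := by
          exact_mod_cast (card_le_card h1).trans (card_union_le _ _)
        have h5 : ((r : ℝ) - 1) * Δ ≤ s * Δ := by
          gcongr
          have : (r : ℝ) ≤ s := by exact_mod_cast hrs
          linarith
        rw [h3] at h2
        have h6 : ((r : ℝ) - 1) * ((#X' : ℝ) * #Y' / s + Δ) =
          ((r : ℝ) - 1) / s * (#X' * #Y') + ((r : ℝ) - 1) * Δ := by ring
        linarith
      have i1 := ih X' (Y \ Y')
      have i2 := ih (X \ X') Y
      rw [cast_card_sdiff hY'] at i1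
      rw [cast_card_sdiff hX'] at i2
      have harea : γ ^ 2 * (#X * #Y : ℝ) ≤ #X' * #Y' := by
        calc γ ^ 2 * (#X * #Y : ℝ) = (γ * #X) * (γ * #Y) := by ring
          _ ≤ (γ₀ * #X) * (γ₀ * #Y) := by gcongr
          _ ≤ _ := by gcongr
      have hp : (1 - γ ^ 2) ^ t * (#X * #Y - #X' * #Y' : ℝ) ≤
          (1 - γ ^ 2) ^ (t + 1) * (#X * #Y) := by
        rw [pow_succ (1 - γ ^ 2), mul_assoc]
        refine mul_le_mul_of_nonneg_left ?_ (by positivity)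
        linarith
      have hE3 : s * Δ ≤ 3 ^ t * (s * Δ + N * ((m : ℝ) + n)) :=
        le_trans (by simp; positivity) (le_mul_of_one_le_left hE h3t)
      rw [hsplit, pow_succ 3]
      linarith
    · have h1 : (#X * #Y : ℝ) ≤ N * (m + n) := by
        by_cases hX : N ≤ #X
        · have hY : (#Y : ℝ) ≤ N := by
            exact_mod_cast (not_le.1 fun hY => hsmall ⟨hX, hY⟩).le
          calc (#X * #Y : ℝ) ≤ m * N := by gcongr
            _ ≤ _ := by nlinarith [mul_nonneg (Nat.cast_nonneg (α := ℝ) N) (Nat.cast_nonneg n)]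
        · have hX : (#X : ℝ) ≤ N := by exact_mod_cast (not_le.1 hX).le
          calc (#X * #Y : ℝ) ≤ N * n := by gcongr
            _ ≤ _ := by gcongr; simp
      have h2 : (#X * #Y : ℝ) ≤ 3 ^ (t + 1) * (s * Δ + N * (m + n)) := by
        refine le_trans ?_ (le_mul_of_one_le_left hE (one_le_pow₀ (by norm_num)))
        have : 0 ≤ s * Δ := by positivity
        linarith
      have h3 : 0 ≤ (((r : ℝ) - 1) / s + ε) * (#X * #Y) := by positivity
      have h4 : 0 ≤ (1 - γ ^ 2) ^ (t + 1) * (#X * #Y : ℝ) := by positivity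
      linarith [htriv X Y]

lemma sum_mul_eval_eq_zero {ι κ : Type*} [Fintype ι] [DecidableEq ι] [Fintype κ] (g : κ → ℝ)
    (hg : ∑ v, g v = 0) {i i' : ι} (h : i ≠ i') : ∑ w : ι → κ, g (w i) * g (w i') = 0 := by
  rw [← (Equiv.funSplitAt i κ).symm.sum_comp, Fintype.sum_prod_type, sum_comm]
  refine sum_eq_zero fun w _ => ?_
  simp [Equiv.funSplitAt, Equiv.piSplitAt, h.symm, ← sum_mul, hg]

lemma sum_sq_sum_eval_le {A ι κ : Type*} [Fintype ι] [DecidableEq ι] [Fintype κ]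
    [Fintype A] (g : κ → ℝ) (hg : ∑ v, g v = 0) (hg1 : ∀ v, |g v| ≤ 1) (a : A → ι) (α : ℝ)
    (ha : ∀ i, (#{x | a x = i} : ℝ) ≤ α) (X : Finset A) :
    ∑ w : ι → κ, (∑ x ∈ X, g (w (a x))) ^ 2 ≤
      (Fintype.card κ) ^ (Fintype.card ι) * (Fintype.card ι * α ^ 2) := by
  have hcard : (Fintype.card A : ℝ) ≤ Fintype.card ι * α := by
    rw [← card_univ, card_eq_sum_card_fiberwise (f := a) (t := univ) (by simp)]
    push_cast
    calc _ ≤ ∑ _i : ι, α := sum_le_sum fun i _ => ha i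
      _ = _ := by simp
  have hpair : ∀ x x' : A, ∑ w : ι → κ, g (w (a x)) * g (w (a x')) ≤
      if a x' = a x then (Fintype.card κ : ℝ) ^ (Fintype.card ι) else 0 := by
    intro x x'
    split_ifs with h
    · calc _ ≤ ∑ _w : ι → κ, (1 : ℝ) := sum_le_sum fun w _ => by
            rw [h, ← abs_mul_abs_self]
            nlinarith [hg1 (w (a x)), abs_nonneg (g (w (a x)))]
        _ = _ := by simp
    · exact (sum_mul_eval_eq_zero g hg (Ne.symm h)).le
  calc ∑ w : ι → κ, (∑ x ∈ X, g (w (a x))) ^ 2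
      = ∑ x ∈ X, ∑ x' ∈ X, ∑ w : ι → κ, g (w (a x)) * g (w (a x')) := by
        simp_rw [sq, sum_mul_sum]
        rw [sum_comm]
        exact sum_congr rfl fun x _ => sum_comm
    _ ≤ ∑ x ∈ X, ∑ x' ∈ X, if a x' = a x then (Fintype.card κ : ℝ) ^ (Fintype.card ι) else 0 :=
        sum_le_sum fun x _ => sum_le_sum fun x' _ => hpair x x'
    _ ≤ ∑ x : A, ∑ x' : A, if a x' = a x then (Fintype.card κ : ℝ) ^ (Fintype.card ι) else 0 := by
        refine (sum_le_sum fun x _ => sum_le_univ_sum_of_nonneg fun x' => by positivity).trans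
          (sum_le_univ_sum_of_nonneg fun x => by positivity)
    _ ≤ ∑ _x : A, α * (Fintype.card κ : ℝ) ^ (Fintype.card ι) := by
        refine sum_le_sum fun x _ => ?_
        rw [← sum_filter, sum_const, nsmul_eq_mul]
        gcongr
        exact ha _
    _ = Fintype.card A * (α * (Fintype.card κ : ℝ) ^ (Fintype.card ι)) := by simp
    _ ≤ _ := by
        rcases isEmpty_or_nonempty A with hA | ⟨⟨x⟩⟩
        · simp; positivity
        · have hα : 0 ≤ α := (Nat.cast_nonneg _).trans (ha (a x))
          calc _ ≤ (Fintype.card ι * α) * (α * (Fintype.card κ : ℝ) ^ (Fintype.card ι)) := by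
                gcongr
            _ = _ := by ring

/-- The matrix whose columns run evenly through all words in the letters `κ` has its entries
evenly distributed on every rectangle. -/
lemma card_eval_eq_le {A B ι κ : Type*} [Fintype ι] [DecidableEq ι] [Fintype κ] [DecidableEq κ]
    [Fintype A] [Fintype B] (a : A → ι) (b : B → ι → κ) (α β : ℝ) (hα : 0 ≤ α) (hβ : 0 ≤ β)
    (ha : ∀ i, (#{x | a x = i} : ℝ) ≤ α) (hb : ∀ w, (#{y | b y = w} : ℝ) ≤ β)
    (X : Finset A) (Y : Finset B) (c : κ) :
    (#{q ∈ X ×ˢ Y | b q.2 (a q.1) = c} : ℝ) ≤ #X * #Y / Fintype.card κ +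
      β * ((Fintype.card κ) ^ (Fintype.card ι) * (√(Fintype.card ι) * α)) := by
  have hκ : (1 : ℝ) ≤ Fintype.card κ := by
    exact_mod_cast Fintype.card_pos_iff.2 ⟨c⟩
  set g : κ → ℝ := fun v => (if v = c then 1 else 0) - 1 / Fintype.card κ with hgdef
  have hg : ∑ v, g v = 0 := by
    simp only [hgdef, sum_sub_distrib, sum_ite_eq', mem_univ, if_true, sum_const, card_univ,
      nsmul_eq_mul]
    field_simp
    simp
  have hg1 : ∀ v, |g v| ≤ 1 := by
    intro v
    have h1 : 1 / (Fintype.card κ : ℝ) ≤ 1 := by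
      rw [div_le_one (by linarith)]; exact hκ
    have h0 : 0 ≤ 1 / (Fintype.card κ : ℝ) := by positivity
    simp only [hgdef]
    rw [abs_le]
    split_ifs <;> constructor <;> linarith
  set h : (ι → κ) → ℝ := fun w => ∑ x ∈ X, g (w (a x)) with hh
  have hsq := sum_sq_sum_eval_le g hg hg1 a α ha X
  have hcs : ∑ w, |h w| ≤ (Fintype.card κ) ^ (Fintype.card ι) * (√(Fintype.card ι) * α) := by
    refine abs_le_of_sq_le_sq' ?_ (by positivity) |>.2
    calc (∑ w, |h w|) ^ 2 ≤ Fintype.card (ι → κ) * ∑ w, |h w| ^ 2 := sq_sum_le_card_mul_sum_sq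
      _ ≤ (Fintype.card κ) ^ (Fintype.card ι) *
          ((Fintype.card κ) ^ (Fintype.card ι) * (Fintype.card ι * α ^ 2)) := by
          simp only [sq_abs, Fintype.card_fun, Nat.cast_pow]
          gcongr
      _ = _ := by
          have : √(Fintype.card ι : ℝ) ^ 2 = Fintype.card ι := Real.sq_sqrt (by positivity)
          linear_combination (-((Fintype.card κ : ℝ) ^ (Fintype.card ι)) ^ 2 * α ^ 2) * this
  have hcount : (#{q ∈ X ×ˢ Y | b q.2 (a q.1) = c} : ℝ) =
      #X * #Y / Fintype.card κ + ∑ y ∈ Y, h (b y) := by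
    simp only [hh, hgdef, sum_sub_distrib, sum_const, nsmul_eq_mul, card_filter, sum_product_right]
    push_cast
    ring
  have hY : ∑ y ∈ Y, h (b y) ≤ β * ∑ w, |h w| := by
    calc ∑ y ∈ Y, h (b y) ≤ ∑ y ∈ Y, |h (b y)| := sum_le_sum fun y _ => le_abs_self _
      _ ≤ ∑ y, |h (b y)| := sum_le_univ_sum_of_nonneg fun y => abs_nonneg _
      _ = ∑ w, ∑ y with b y = w, |h (b y)| := (sum_fiberwise _ _ _).symm
      _ = ∑ w, #{y | b y = w} * |h w| := by
          refine sum_congr rfl fun w _ => ?_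
          rw [← nsmul_eq_mul, ← sum_const]
          exact sum_congr rfl fun y hy => by rw [(mem_filter.1 hy).2]
      _ ≤ ∑ w, β * |h w| := sum_le_sum fun w _ => by gcongr; exact hb w
      _ = _ := (mul_sum _ _ _).symm
  rw [hcount]
  gcongr
  exact hY.trans (mul_le_mul_of_nonneg_left hcs hβ)

lemma exists_balanced_map (ι : Type*) [Fintype ι] [DecidableEq ι] [Nonempty ι] (m : ℕ) :
    ∃ a : Fin m → ι, ∀ i, #{x | a x = i} ≤ m / Fintype.card ι + 1 := by
  have hK : 0 < Fintype.card ι := Fintype.card_pos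
  refine ⟨fun x => (Fintype.equivFin ι).symm ⟨x % Fintype.card ι, Nat.mod_lt _ hK⟩, fun i => ?_⟩
  rw [← card_range (m / Fintype.card ι + 1)]
  refine card_le_card_of_injOn (fun x => (x : ℕ) / Fintype.card ι) ?_ ?_
  · intro x _
    simp only [coe_range, Set.mem_Iio, Nat.lt_succ_iff]
    exact Nat.div_le_div_right x.2.le
  · intro x hx y hy hxy
    simp only [coe_filter, mem_univ, true_and, Set.mem_ofPred_eq] at hx hy
    have h := (Fintype.equivFin ι).symm.injective (hx.trans hy.symm)
    have hmod : (x : ℕ) % Fintype.card ι = y % Fintype.card ι := congrArg Fin.val h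
    have hdiv : (x : ℕ) / Fintype.card ι = y / Fintype.card ι := hxy
    ext
    rw [← Nat.div_add_mod (x : ℕ) (Fintype.card ι), ← Nat.div_add_mod (y : ℕ) (Fintype.card ι),
      hmod, hdiv]

/-- There are matrices whose colours are evenly distributed on all rectangles. -/
lemma exists_matrix_equidistributed (s : ℕ) (hs : 0 < s) (δ : ℝ) (hδ : 0 < δ) :
    ∃ N : ℕ, ∀ m n : ℕ, N ≤ m → N ≤ n → ∃ M : Fin m → Fin n → Fin s,
      ∀ X Y c, (#{q ∈ X ×ˢ Y | M q.1 q.2 = c} : ℝ) ≤ #X * #Y / s + δ * (m * n) := by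
  obtain ⟨K, hK⟩ := exists_nat_gt ((4 / δ) ^ 2)
  have hK0 : (0 : ℝ) < K := (by positivity : (0 : ℝ) ≤ (4 / δ) ^ 2).trans_lt hK
  have hK1 : 0 < K := by exact_mod_cast hK0
  have : NeZero s := ⟨hs.ne'⟩
  have : NeZero K := ⟨hK1.ne'⟩
  have hbound : ∀ (x u : ℕ), 0 < u → u ≤ x → ((x / u + 1 : ℕ) : ℝ) ≤ 2 * x / u := by
    intro x u hu hux
    have hu' : (0 : ℝ) < u := by exact_mod_cast hu
    have h1 : (1 : ℝ) ≤ x / u := by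
      rw [one_le_div hu']; exact_mod_cast hux
    have h2 := Nat.cast_div_le (α := ℝ) (m := x) (n := u)
    push_cast
    rw [mul_div_assoc]
    linarith
  refine ⟨K + s ^ K, fun m n hm hn => ?_⟩
  obtain ⟨a, ha⟩ := exists_balanced_map (Fin K) m
  obtain ⟨b, hb⟩ := exists_balanced_map (Fin K → Fin s) n
  refine ⟨fun i j => b j (a i), fun X Y c => ?_⟩
  have hsK : 0 < s ^ K := by positivity
  simp only [Fintype.card_fin, Fintype.card_fun] at ha hb
  have h := card_eval_eq_le a b (2 * m / K) (2 * n / (s ^ K : ℕ)) (by positivity) (by positivity)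
    (fun i => le_trans (by exact_mod_cast ha i) (hbound m K hK1 (by omega)))
    (fun w => le_trans (by exact_mod_cast hb w) (hbound n (s ^ K) hsK (by omega))) X Y c
  simp only [Fintype.card_fin] at h
  have hsq : 4 / δ ≤ √K := Real.le_sqrt_of_sq_le hK.le
  rw [div_le_iff₀ hδ] at hsq
  have hsK' : (0 : ℝ) < (s : ℝ) ^ K := by exact_mod_cast hsK
  have hk2 : √(K : ℝ) ^ 2 = K := Real.sq_sqrt hK0.le
  have hk0 : 0 < √(K : ℝ) := Real.sqrt_pos.2 hK0
  have : (2 * n / ((s ^ K : ℕ) : ℝ)) * ((s : ℝ) ^ K * (√K * (2 * m / K))) =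
      4 / √K * (m * n) := by
    push_cast
    nth_rewrite 2 [← hk2]
    field_simp
    ring
  rw [this] at h
  refine h.trans ?_
  gcongr
  rw [div_le_iff₀ hk0]
  linarith

lemma not_hasSubpattern_of_mem {s r m n m' n' : ℕ} {P : Fin m' × Fin n' → Fin r}
    (hP : Function.Surjective P) (F : Fin m → Fin n → Fin s) (T : Finset (Fin s)) (hT : #T < r)
    (hF : ∀ i j, F i j ∈ T) : ¬ HasSubpattern F P := by
  rintro ⟨φ, ψ, h⟩
  choose p hp using hP
  refine hT.not_ge ?_
  rw [← Fintype.card_fin r, ← card_univ]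
  refine card_le_card_of_injOn (fun k => F (φ (p k).1) (ψ (p k).2)) (fun k _ => hF _ _) ?_
  intro k _ l _ hkl
  simpa [hp] using (h _ _ _ _).1 hkl

/-- Some `k` cyclically consecutive colours have at least their average share of the weight. -/
lemma exists_heavy_subset {s : ℕ} [NeZero s] (w : Fin s → ℝ) (k : ℕ)
    (hk : k ≤ s) :
    ∃ T : Finset (Fin s), #T = k ∧ (k : ℝ) / s * ∑ c, w c ≤ ∑ c ∈ T, w c := by
  let T : Fin s → Finset (Fin s) := fun a =>
    univ.map ((Fin.castLEEmb hk).trans (Equiv.addRight a).toEmbedding)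
  have hT : ∀ a, ∑ c ∈ T a, w c = ∑ i : Fin k, w (Fin.castLE hk i + a) := by
    intro a
    simp [T]
  by_contra! h
  have h1 : ∑ a, ∑ c ∈ T a, w c < ∑ _a : Fin s, (k : ℝ) / s * ∑ c, w c :=
    sum_lt_sum_of_nonempty univ_nonempty fun a _ => h (T a) (by simp [T])
  have h2 : ∑ a, ∑ c ∈ T a, w c = k * ∑ c, w c := by
    simp_rw [hT]
    rw [sum_comm]
    have h3 : ∀ i : Fin k, ∑ a, w (Fin.castLE hk i + a) = ∑ c, w c :=
      fun i => Equiv.sum_comp (Equiv.addLeft (Fin.castLE hk i)) w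
    simp [h3]
  have hs : (s : ℝ) ≠ 0 := by exact_mod_cast NeZero.ne s
  rw [h2, sum_const, card_univ, Fintype.card_fin, nsmul_eq_mul, ← mul_assoc,
    mul_div_cancel₀ _ hs] at h1
  exact h1.false

lemma exists_avoiding_near {s r m' n' m n : ℕ} (hr : 2 ≤ r) (hrs : r ≤ s)
    (P : Fin m' × Fin n' → Fin r) (hP : Function.Surjective P) (M : Fin m → Fin n → Fin s) :
    ∃ F : Fin m → Fin n → Fin s, ¬ HasSubpattern F P ∧
      (MatDist M F : ℝ) ≤ (((s : ℝ) - r + 1) / s) * m * n := by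
  have : NeZero s := ⟨by omega⟩
  have hs : (0 : ℝ) < s := by exact_mod_cast (by omega : 0 < s)
  obtain ⟨T, hT, hw⟩ := exists_heavy_subset
    (fun c => (#{q : Fin m × Fin n | M q.1 q.2 = c} : ℝ)) (r - 1) (by omega)
  obtain ⟨c, hc⟩ : T.Nonempty := card_pos.1 (by omega)
  refine ⟨fun i j => if M i j ∈ T then M i j else c,
    not_hasSubpattern_of_mem hP _ T (by omega) (fun i j => by split_ifs <;> assumption), ?_⟩
  have h1 : ∑ c, (#{q : Fin m × Fin n | M q.1 q.2 = c} : ℝ) = m * n := by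
    rw [← Nat.cast_sum, ← card_eq_sum_card_fiberwise (by simp)]
    simp
  have h2 : ∑ c ∈ T, (#{q : Fin m × Fin n | M q.1 q.2 = c} : ℝ) =
      #{q : Fin m × Fin n | M q.1 q.2 ∈ T} := by
    rw [← Nat.cast_sum, card_eq_sum_card_fiberwise (f := fun q => M q.1 q.2) (t := T)
      (fun q hq => by simpa using hq)]
    congr 1
    refine sum_congr rfl fun d hd => ?_
    rw [filter_filter]
    congr 1
    ext q
    simp only [mem_filter, mem_univ, true_and]
    exact ⟨fun h => ⟨h ▸ hd, h⟩, fun h => h.2⟩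
  have h3 : #{q : Fin m × Fin n | M q.1 q.2 ∈ T} + #{q : Fin m × Fin n | M q.1 q.2 ∉ T} = m * n := by
    rw [card_filter_add_card_filter_not]; simp
  have h4 : MatDist M (fun i j => if M i j ∈ T then M i j else c) ≤
      #{q : Fin m × Fin n | M q.1 q.2 ∉ T} := by
    refine card_le_card fun q hq => ?_
    simp only [mem_filter, mem_univ, true_and] at hq ⊢
    intro h
    simp [h] at hq
  have h3' : (#{q : Fin m × Fin n | M q.1 q.2 ∈ T} : ℝ) + #{q : Fin m × Fin n | M q.1 q.2 ∉ T} =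
      m * n := by exact_mod_cast h3
  have h4' : (MatDist M (fun i j => if M i j ∈ T then M i j else c) : ℝ) ≤
      #{q : Fin m × Fin n | M q.1 q.2 ∉ T} := by exact_mod_cast h4
  rw [h1, h2, Nat.cast_sub (by omega), Nat.cast_one] at hw
  have h5 : (((s : ℝ) - r + 1) / s) * m * n = m * n - ((r : ℝ) - 1) / s * (m * n) := by
    field_simp
    ring
  linarith

/-- **Theorem 1.1 (matrix editing, asymptotic value).**
Let `s ≥ r ≥ 2` be fixed, let `P` be a pattern with `r` nonempty classes on an `m' × n'` array,
and let `b₁, b₂ > 0`.  Then `f(m,n; s, P) = (1+o(1)) ((s-r+1)/s) mn` as `m+n → ∞` subject to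
`b₁ ≤ m/n ≤ b₂`:  for every `ε > 0` there is `N` such that for all `m, n` with `m+n ≥ N` and
`b₁ ≤ m/n ≤ b₂`, every `m × n` matrix with at most `s` distinct entries can be edited into a
`P`-subpattern-free matrix (with at most `s` distinct entries) in at most `((s-r+1)/s) mn`
positions, and some matrix requires at least `(1-ε) ((s-r+1)/s) mn` edits. -/
theorem matrix_editing_asymptotic
    (s r m' n' : ℕ) (hr : 2 ≤ r) (hrs : r ≤ s)
    (P : Fin m' × Fin n' → Fin r) (hP : Function.Surjective P)
    (b₁ b₂ : ℝ) (hb₁ : 0 < b₁) (hb₂ : 0 < b₂)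
    (ε : ℝ) (hε : 0 < ε) :
    ∃ N : ℕ, ∀ m n : ℕ, 0 < m → 0 < n → N ≤ m + n →
      b₁ ≤ (m : ℝ) / n → (m : ℝ) / n ≤ b₂ →
      ((∀ M : Fin m → Fin n → Fin s, ∃ F : Fin m → Fin n → Fin s,
          ¬ HasSubpattern F P ∧
          (MatDist M F : ℝ) ≤ (((s : ℝ) - r + 1) / s) * m * n) ∧
       (∃ M : Fin m → Fin n → Fin s, ∀ F : Fin m → Fin n → Fin s,
          ¬ HasSubpattern F P →
          (1 - ε) * (((s : ℝ) - r + 1) / s) * m * n ≤ (MatDist M F : ℝ))) := by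
  have hs : (0 : ℝ) < s := by exact_mod_cast (by omega : 0 < s)
  have hc : 0 < ((s : ℝ) - r + 1) / s := by
    have : (r : ℝ) ≤ s := by exact_mod_cast hrs
    exact div_pos (by linarith) hs
  set e := min 1 (ε * (((s : ℝ) - r + 1) / s) / 5)
  have he : 0 < e := by positivity
  have he1 : e ≤ 1 := min_le_left _ _
  have he2 : e ≤ ε * (((s : ℝ) - r + 1) / s) / 5 := min_le_right _ _
  obtain ⟨γ, hγ, hγ1, N, hN⟩ := card_agree_le (by omega : 1 ≤ r) hrs P e he he1
  obtain ⟨t, ht⟩ := exists_pow_lt_of_lt_one he (by nlinarith : 1 - γ ^ 2 < 1)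
  obtain ⟨N', hN'⟩ := exists_matrix_equidistributed s (by omega) (e / (3 ^ t * s)) (by positivity)
  set Q := (N' : ℝ) + 3 ^ t * N / e
  have hQ : 0 ≤ Q := by positivity
  refine ⟨⌈Q * (1 + 1 / b₁) + Q * (1 + b₂)⌉₊, fun m n hm hn hmn h₁ h₂ =>
    ⟨exists_avoiding_near hr hrs P hP, ?_⟩⟩
  have hn' : (0 : ℝ) < n := by exact_mod_cast hn
  have hmn' : Q * (1 + 1 / b₁) + Q * (1 + b₂) ≤ m + n := by
    exact_mod_cast Nat.ceil_le.1 hmn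
  rw [le_div_iff₀ hn'] at h₁
  rw [div_le_iff₀ hn'] at h₂
  have hQ₁ : 0 ≤ Q * (1 + 1 / b₁) := by positivity
  have hQ₂ : 0 ≤ Q * (1 + b₂) := by positivity
  have hQm : Q ≤ m := by
    have h : (n : ℝ) ≤ m * (1 / b₁) := by
      rw [mul_one_div, le_div_iff₀ hb₁]; linarith
    have : Q * (1 + 1 / b₁) ≤ m * (1 + 1 / b₁) := by linarith
    exact le_of_mul_le_mul_right this (by positivity)
  have hQn : Q ≤ n := by
    have : Q * (1 + b₂) ≤ n * (1 + b₂) := by linarith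
    exact le_of_mul_le_mul_right this (by positivity)
  have hQN' : (N' : ℝ) ≤ Q := by simp only [Q]; linarith [show 0 ≤ 3 ^ t * N / e by positivity]
  have hQN : 3 ^ t * N ≤ e * Q := by
    have : e * (3 ^ t * N / e) = 3 ^ t * N := by field_simp
    simp only [Q]
    nlinarith [mul_nonneg he.le (Nat.cast_nonneg (α := ℝ) N')]
  obtain ⟨M, hM⟩ := hN' m n (by exact_mod_cast hQN'.trans hQm) (by exact_mod_cast hQN'.trans hQn)
  refine ⟨M, fun F hF => ?_⟩
  have hagree := hN m n F M _ (by positivity) hF hM t univ univ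
  have hdist : (#{q : Fin m × Fin n | M q.1 q.2 = F q.1 q.2} : ℝ) + MatDist M F = m * n := by
    have : #{q : Fin m × Fin n | M q.1 q.2 = F q.1 q.2} + MatDist M F = m * n := by
      rw [MatDist, card_filter_add_card_filter_not]
      simp
    exact_mod_cast this
  rw [univ_product_univ, card_univ, card_univ, Fintype.card_fin, Fintype.card_fin] at hagree
  have e1 : (1 - γ ^ 2) ^ t * ((m : ℝ) * n) ≤ e * (m * n) := by gcongr
  have e2 : 3 ^ t * (s * (e / (3 ^ t * s) * (m * n))) = e * ((m : ℝ) * n) := by field_simp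
  have e3 : 3 ^ t * N * (m : ℝ) ≤ e * (m * n) := by
    calc 3 ^ t * N * (m : ℝ) ≤ e * n * m := by
          refine mul_le_mul_of_nonneg_right (hQN.trans ?_) (by positivity)
          gcongr
      _ = _ := by ring
  have e4 : 3 ^ t * N * (n : ℝ) ≤ e * (m * n) := by
    calc 3 ^ t * N * (n : ℝ) ≤ e * m * n := by
          refine mul_le_mul_of_nonneg_right (hQN.trans ?_) (by positivity)
          gcongr
      _ = _ := by ring
  have e5 : 5 * e * ((m : ℝ) * n) ≤ ε * (((s : ℝ) - r + 1) / s) * (m * n) :=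
    mul_le_mul_of_nonneg_right (by linarith) (by positivity)
  have e6 : ((r : ℝ) - 1) / s = 1 - ((s : ℝ) - r + 1) / s := by
    field_simp
    ring
  rw [e6] at hagree
  linarith
end

section
/- Let 0 < ε < 1 be fixed, let s ≥ r ≥ 2 and m', n' be fixed positive integers, and let A be a pattern with r color classes on the edges of K_{m',n'}. Then for all m, n with m+n sufficiently large, F(m,n; s, A) ≥ (1 − ε·(5s + 2 + (s+1)·(m/n + n/m)))·((s−r+1)/s)·mn. -/
open Finset

/-- A coloring `c` of the edges of `K_{m,n}` contains an occurrence of the pattern `P`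
(a surjective labeling of the edges of `K_{m',n'}` by `r` classes): there exist injections
`φ`, `ψ` of the two sides such that colors agree exactly on positions in the same class. -/
def ContainsPattern {m n m' n' r s : ℕ} (c : Fin m → Fin n → Fin s)
    (P : Fin m' × Fin n' → Fin r) : Prop :=
  ∃ φ : Fin m' ↪ Fin m, ∃ ψ : Fin n' ↪ Fin n,
    ∀ i i' : Fin m', ∀ j j' : Fin n',
      (c (φ i) (ψ j) = c (φ i') (ψ j') ↔ P (i, j) = P (i', j'))

/-- The number of edges of `K_{m,n}` on which the colorings `c` and `c'` differ. -/
def ColDist {m n s : ℕ} (c c' : Fin m → Fin n → Fin s) : ℕ :=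
  (univ.filter fun p : Fin m × Fin n => c p.1 p.2 ≠ c' p.1 p.2).card

/-- A coloring contains every pattern with at most `r` classes on `K_{m',n'}` as soon as some
`m' + n'` rows realize all the vectors with entries in a fixed set of `r` colors. -/
theorem containsPattern_of_shatters {t M s r m' n' : ℕ} (f : Fin t → Fin M → Fin s)
    (P : Fin m' × Fin n' → Fin r) (hr : 2 ≤ r) (e : Fin r ↪ Fin s) (g : ℕ → Fin t)
    (h : ∀ κ : ℕ → Fin r, ∃ x, ∀ k < m' + n', f (g k) x = e (κ k)) :
    ContainsPattern f P := by
  let a₀ : Fin r := ⟨0, by omega⟩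
  let a₁ : Fin r := ⟨1, by omega⟩
  have ha : a₀ ≠ a₁ := by simp [a₀, a₁]
  have hg : ∀ k < m' + n', ∀ k' < m' + n', g k = g k' → k = k' := by
    intro k hk k' hk' hgk
    by_contra hne
    obtain ⟨x, hx⟩ := h (fun l => if l = k then a₀ else a₁)
    have h1 := hx k hk
    have h2 := hx k' hk'
    rw [if_pos rfl] at h1
    rw [if_neg (Ne.symm hne), ← hgk, h1] at h2
    exact ha (e.injective h2)
  let κ : Fin n' → ℕ → Fin r := fun j k =>
    if hk : k < m' then P (⟨k, hk⟩, j) else if k = m' + j then a₀ else a₁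
  choose ψ hψ using fun j => h (κ j)
  refine ⟨⟨fun i => g i, fun i i' hi => Fin.ext (hg _ (by omega) _ (by omega) hi)⟩,
    ⟨ψ, fun j j' hj => ?_⟩, fun i i' j j' => ?_⟩
  · by_contra hne
    have hne' : (j : ℕ) ≠ j' := fun hh => hne (Fin.ext hh)
    have h1 := hψ j (m' + j) (by omega)
    have h2 := hψ j' (m' + j) (by omega)
    rw [hj, h2] at h1
    have h3 := e.injective h1
    simp only [κ] at h3
    rw [dif_neg (by omega), dif_neg (by omega), if_neg (by omega)] at h3
    exact ha (by simpa using h3.symm)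
  · have key : ∀ (i : Fin m') (j : Fin n'), f (g i) (ψ j) = e (P (i, j)) := by
      intro i j
      rw [hψ j i (by omega)]
      simp [κ]
    change f (g i) (ψ j) = f (g i') (ψ j') ↔ _
    rw [key, key, e.injective.eq_iff]

/-- If a coloring avoids a pattern, every nonempty set `B` of columns splits into boundedly many
parts such that each row has a color in the range of `e` that is rare on a large part. -/
theorem exists_partition_of_not_containsPattern {t M s r m' n' : ℕ}
    (f : Fin t → Fin M → Fin s) (P : Fin m' × Fin n' → Fin r) (hr : 2 ≤ r)
    (hf : ¬ ContainsPattern f P) (e : Fin r ↪ Fin s) (B : Finset (Fin M)) (hB : B.Nonempty)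
    (η : ℝ) (hη0 : 0 < η) (hη1 : η ≤ 1) :
    ∃ q : Fin M → Fin (m' + n') → Fin s, ∀ i, ∃ z, ∃ a : Fin r,
      η ^ (m' + n') * #B ≤ #{x ∈ B | q x = z} ∧
      (#{x ∈ B | q x = z ∧ f i x = e a} : ℝ) ≤ η * #{x ∈ B | q x = z} := by
  by_contra! hcon
  have hBpos : (0 : ℝ) < #B := by exact_mod_cast hB.card_pos
  let a₀ : Fin r := ⟨0, by omega⟩
  obtain ⟨i₀, -⟩ := hcon fun _ _ => e a₀
  have main : ∀ l ≤ m' + n', ∃ g : ℕ → Fin t, ∀ κ : ℕ → Fin r,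
      η ^ l * #B ≤ #{x ∈ B | ∀ k < l, f (g k) x = e (κ k)} := by
    intro l
    induction l with
    | zero => exact fun _ => ⟨fun _ => i₀, fun κ => by simp⟩
    | succ l ih =>
      intro hl
      obtain ⟨g, hg⟩ := ih (by omega)
      obtain ⟨i, hi⟩ := hcon fun x k => if (k : ℕ) < l then f (g k) x else e a₀
      refine ⟨Function.update g l i, fun κ => ?_⟩
      have hz := hi (fun k => if (k : ℕ) < l then e (κ k) else e a₀) (κ l)
      have hset : ∀ x, ((fun k : Fin (m' + n') => if (k : ℕ) < l then f (g k) x else e a₀) =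
          fun k : Fin (m' + n') => if (k : ℕ) < l then e (κ k) else e a₀) ↔
          ∀ k < l, f (g k) x = e (κ k) := by
        intro x
        constructor
        · intro hx k hk
          have := congrFun hx ⟨k, by omega⟩
          simpa [hk] using this
        · intro hx
          funext k
          by_cases hk : (k : ℕ) < l
          · simp [hk, hx k hk]
          · simp [hk]
      simp only [hset] at hz
      have h1 := hz ((mul_le_mul_of_nonneg_right
        (pow_le_pow_of_le_one hη0.le hη1 (by omega)) hBpos.le).trans (hg κ))
      have h2 : ({x ∈ B | ∀ k < l + 1, f (Function.update g l i k) x = e (κ k)} : Finset _) =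
          {x ∈ B | (∀ k < l, f (g k) x = e (κ k)) ∧ f i x = e (κ l)} := by
        refine filter_congr fun x _ => ⟨fun hx => ⟨fun k hk => ?_, ?_⟩, fun hx k hk => ?_⟩
        · simpa [Function.update_of_ne hk.ne] using hx k (by omega)
        · simpa using hx l (by omega)
        · rcases Nat.lt_succ_iff_lt_or_eq.mp hk with hk | rfl
          · simpa [Function.update_of_ne hk.ne] using hx.1 k hk
          · simpa using hx.2
      rw [h2]
      calc η ^ (l + 1) * #B = η * (η ^ l * #B) := by ring
        _ ≤ η * _ := mul_le_mul_of_nonneg_left (hg κ) hη0.le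
        _ ≤ _ := h1.le
  obtain ⟨g, hg⟩ := main _ le_rfl
  refine hf (containsPattern_of_shatters f P hr e g fun κ => ?_)
  have hpos : (0 : ℝ) < #{x ∈ B | ∀ k < m' + n', f (g k) x = e (κ k)} :=
    (by positivity : (0 : ℝ) < η ^ (m' + n') * #B).trans_le (hg κ)
  obtain ⟨x, hx⟩ := card_pos.mp (by exact_mod_cast hpos)
  exact ⟨x, (mem_filter.mp hx).2⟩

/-- Deleting from the lists the colors of density at most `η` in the parts of a partition creates
at most `η` times as many errors as the total decrease of the list sizes. -/
theorem error_add_le_of_remove_rare {X W C : Type*} [Fintype X] [DecidableEq W]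
    [DecidableEq C] (h : X → W) (L L' : X → Finset C) (c : X → C) (η : ℝ)
    (hL : ∀ x y, h x = h y → L x = L y)
    (hL' : ∀ x, L' x = {a ∈ L x | η * #{y | h y = h x} < #{y | h y = h x ∧ c y = a}}) :
    (#{x | c x ∉ L' x} : ℝ) + η * ∑ x, (#(L' x) : ℝ) ≤
      #{x | c x ∉ L x} + η * ∑ x, (#(L x) : ℝ) := by
  have hsub : ∀ x, L' x ⊆ L x := fun x => by rw [hL']; exact filter_subset _ _
  classical
  have h1 : ({x | c x ∉ L' x} : Finset X) ⊆
      ({x | c x ∉ L x} : Finset X) ∪ ({x | c x ∈ L x \ L' x} : Finset X) := by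
    intro x hx
    simp only [mem_union, mem_filter, mem_univ, true_and, mem_sdiff] at hx ⊢
    tauto
  have h2 : (#{x | c x ∉ L' x} : ℝ) ≤ #{x | c x ∉ L x} + #{x | c x ∈ L x \ L' x} := by
    exact_mod_cast (card_le_card h1).trans (card_union_le _ _)
  have h3 : (#{x | c x ∈ L x \ L' x} : ℝ) ≤ η * ∑ x, (#(L x \ L' x) : ℝ) := by
    have e1 : (#{x | c x ∈ L x \ L' x} : ℝ) = ∑ x, if c x ∈ L x \ L' x then (1 : ℝ) else 0 := by
      simp
    rw [e1, mul_sum, ← sum_fiberwise_of_maps_to (s := univ) (t := univ.image h) (g := h)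
      (fun x _ => mem_image_of_mem h (mem_univ x)),
      ← sum_fiberwise_of_maps_to (s := univ) (t := univ.image h) (g := h)
      (fun x _ => mem_image_of_mem h (mem_univ x))]
    refine sum_le_sum fun w hw => ?_
    obtain ⟨x₀, -, rfl⟩ := mem_image.mp hw
    have hc : ∀ x, h x = h x₀ → L x \ L' x = L x₀ \ L' x₀ := by
      intro x hx
      rw [hL' x, hL' x₀, hL x x₀ hx, hx]
    have e2 : ∑ x with h x = h x₀, (if c x ∈ L x \ L' x then (1 : ℝ) else 0) =
        ∑ x with h x = h x₀, ∑ a ∈ L x₀ \ L' x₀, if c x = a then (1 : ℝ) else 0 := by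
      refine sum_congr rfl fun x hx => ?_
      rw [hc x (mem_filter.mp hx).2]
      simp
    have e3 : ∑ x with h x = h x₀, η * (#(L x \ L' x) : ℝ) =
        ∑ a ∈ L x₀ \ L' x₀, η * #{y | h y = h x₀} := by
      rw [sum_congr rfl fun x hx => by rw [hc x (mem_filter.mp hx).2]]
      simp only [sum_const, nsmul_eq_mul]
      ring
    rw [e2, e3, sum_comm]
    refine sum_le_sum fun a ha => ?_
    rw [mem_sdiff, hL', mem_filter, not_and] at ha
    have := not_lt.mp (ha.2 ha.1)
    rwa [← sum_filter, filter_filter, sum_const, nsmul_eq_mul, mul_one]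
  have h4 : ∀ x, (#(L x \ L' x) : ℝ) = #(L x) - #(L' x) := fun x => by
    rw [cast_card_sdiff (hsub x)]
  simp only [h4, sum_sub_distrib] at h3
  linarith

/-- The total size of the lists of colors allowed on the edges. -/
def listSize {t M s : ℕ} (L : Fin M → Fin t → Finset (Fin s)) : ℝ :=
  ∑ i, ∑ x, (#(L x i) : ℝ)

/-- The number of edges whose color is not in their list. -/
def listError {t M s : ℕ} (f : Fin t → Fin M → Fin s) (L : Fin M → Fin t → Finset (Fin s)) : ℝ :=
  ∑ i, (#{x | f i x ∉ L x i} : ℝ)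

/-- Some `r` colors belong simultaneously to a proportion `δ` of the lists. -/
def IsRich {t s : ℕ} (r : ℕ) (δ : ℝ) (l : Fin t → Finset (Fin s)) : Prop :=
  ∃ e : Fin r ↪ Fin s, δ * t ≤ #{i | ∀ a, e a ∈ l i}

open Classical in
/-- If many columns have rich lists, the lists can be refined so that their total size drops by a
definite proportion, with few new errors and boundedly many times more distinct lists. -/
theorem exists_refinement {t M s r m' n' : ℕ} (f : Fin t → Fin M → Fin s)
    (P : Fin m' × Fin n' → Fin r) (hr : 2 ≤ r) (hs : 0 < s) (hf : ¬ ContainsPattern f P)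
    (η δ : ℝ) (hη0 : 0 < η) (hη1 : η ≤ 1) (hδ : 0 < δ)
    (L : Fin M → Fin t → Finset (Fin s)) (hL : δ * M ≤ #{x | IsRich r δ (L x)}) :
    ∃ L' : Fin M → Fin t → Finset (Fin s),
      #(univ.image L') ≤ #(univ.image L) * s ^ (m' + n') ∧
      listError f L' + η * listSize L' ≤ listError f L + η * listSize L ∧
      listSize L' + η ^ (m' + n') * δ ^ 2 * t * M ≤ listSize L := by
  let B : (Fin t → Finset (Fin s)) → Finset (Fin M) := fun l => {x | L x = l}
  have hq : ∀ l, ∃ q : Fin M → Fin (m' + n') → Fin s, IsRich r δ l → (B l).Nonempty →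
      ∃ e : Fin r ↪ Fin s, δ * t ≤ #{i | ∀ a, e a ∈ l i} ∧ ∀ i, ∃ z, ∃ a : Fin r,
      η ^ (m' + n') * #(B l) ≤ #{x ∈ B l | q x = z} ∧
      (#{x ∈ B l | q x = z ∧ f i x = e a} : ℝ) ≤ η * #{x ∈ B l | q x = z} := by
    intro l
    by_cases h : IsRich r δ l ∧ (B l).Nonempty
    · obtain ⟨⟨e, he⟩, hB⟩ := h
      obtain ⟨q, hq⟩ :=
        exists_partition_of_not_containsPattern f P hr hf e (B l) hB η hη0 hη1
      exact ⟨q, fun _ _ => ⟨e, he, hq⟩⟩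
    · exact ⟨fun _ _ => ⟨0, hs⟩, fun h1 h2 => absurd ⟨h1, h2⟩ h⟩
  choose q hq using hq
  let h : Fin M → (Fin t → Finset (Fin s)) × (Fin (m' + n') → Fin s) := fun x =>
    (L x, q (L x) x)
  let F : (Fin t → Finset (Fin s)) × (Fin (m' + n') → Fin s) → Fin t → Finset (Fin s) :=
    fun w i => {a ∈ w.1 i | η * #{y | h y = w} < #{y | h y = w ∧ f i y = a}}
  let L' : Fin M → Fin t → Finset (Fin s) := fun x => F (h x)
  have hsub : ∀ x i, L' x i ⊆ L x i := fun x i => filter_subset _ _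
  refine ⟨L', ?_, ?_, ?_⟩
  · have h1 : univ.image L' ⊆ (univ.image L ×ˢ univ).image F := by
      intro l hl
      obtain ⟨x, -, rfl⟩ := mem_image.mp hl
      exact mem_image_of_mem F (mem_product.mpr ⟨mem_image_of_mem L (mem_univ x), mem_univ _⟩)
    refine (card_le_card h1).trans (card_image_le.trans ?_)
    rw [card_product]
    simp
  · have key : ∀ i, (#{x | f i x ∉ L' x i} : ℝ) + η * ∑ x, (#(L' x i) : ℝ) ≤
        #{x | f i x ∉ L x i} + η * ∑ x, (#(L x i) : ℝ) := fun i =>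
      error_add_le_of_remove_rare h (fun x => L x i) (fun x => L' x i) (f i) η
        (fun x y hxy => congrFun (congrArg Prod.fst hxy) i) (fun x => rfl)
    have := sum_le_sum fun i (_ : i ∈ univ) => key i
    simp only [sum_add_distrib, ← mul_sum] at this
    exact this
  · have hdrop : ∀ x i, (0 : ℝ) ≤ #(L x i) - #(L' x i) := fun x i =>
      sub_nonneg.mpr (by exact_mod_cast card_le_card (hsub x i))
    have hclass : ∀ l, (if IsRich r δ l then η ^ (m' + n') * δ * t * #(B l) else 0) ≤
        ∑ x ∈ B l, ∑ i, ((#(L x i) : ℝ) - #(L' x i)) := by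
      intro l
      split_ifs with hl
      swap
      · exact sum_nonneg fun x _ => sum_nonneg fun i _ => hdrop x i
      rcases (B l).eq_empty_or_nonempty with hB | hB
      · simp [hB]
      obtain ⟨e, he, hz⟩ := hq l hl hB
      have hrow : ∀ i ∈ ({i | ∀ a, e a ∈ l i} : Finset (Fin t)),
          η ^ (m' + n') * #(B l) ≤ ∑ x ∈ B l, ((#(L x i) : ℝ) - #(L' x i)) := by
        intro i hi
        obtain ⟨z, a, hz1, hz2⟩ := hz i
        calc η ^ (m' + n') * #(B l) ≤ #{x ∈ B l | q l x = z} := hz1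
          _ = ∑ x ∈ B l with q l x = z, (1 : ℝ) := by simp
          _ ≤ ∑ x ∈ B l with q l x = z, ((#(L x i) : ℝ) - #(L' x i)) := by
            refine sum_le_sum fun x hx => ?_
            have hx1 : L x = l := by simpa [B] using (mem_filter.mp hx).1
            have hx2 : q l x = z := (mem_filter.mp hx).2
            have hh : ∀ y, h y = h x ↔ y ∈ B l ∧ q l y = z := by
              intro y
              simp only [h, Prod.mk.injEq, hx1, hx2, B, mem_filter, mem_univ, true_and]
              constructor
              · rintro ⟨h1, h2⟩
                exact ⟨h1, by rwa [h1] at h2⟩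
              · rintro ⟨h1, h2⟩
                exact ⟨h1, by rwa [h1]⟩
            have hlt : L' x i ⊂ L x i := by
              refine (ssubset_iff_of_subset (hsub x i)).mpr ⟨e a, ?_, ?_⟩
              · rw [hx1]
                exact (mem_filter.mp hi).2 a
              · intro hmem
                have h1 := (mem_filter.mp hmem).2
                have e1 : ({y | h y = h x} : Finset (Fin M)) = {y ∈ B l | q l y = z} := by
                  ext y; simp [hh]
                have e2 : ({y | h y = h x ∧ f i y = e a} : Finset (Fin M)) =
                    {y ∈ B l | q l y = z ∧ f i y = e a} := by
                  ext y; simp [hh, and_assoc]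
                rw [e1, e2] at h1
                exact absurd hz2 (not_le.mpr h1)
            have := card_lt_card hlt
            have : ((#(L' x i) + 1 : ℕ) : ℝ) ≤ #(L x i) := by exact_mod_cast this
            push_cast at this
            linarith
          _ ≤ ∑ x ∈ B l, ((#(L x i) : ℝ) - #(L' x i)) :=
            sum_le_sum_of_subset_of_nonneg (filter_subset _ _) fun x _ _ => hdrop x i
      rw [sum_comm]
      calc η ^ (m' + n') * δ * t * #(B l) = (δ * t) * (η ^ (m' + n') * #(B l)) := by ring
        _ ≤ #{i | ∀ a, e a ∈ l i} * (η ^ (m' + n') * #(B l)) := by gcongr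
        _ = ∑ i with ∀ a, e a ∈ l i, η ^ (m' + n') * #(B l) := by simp
        _ ≤ ∑ i with ∀ a, e a ∈ l i, ∑ x ∈ B l, ((#(L x i) : ℝ) - #(L' x i)) :=
          sum_le_sum hrow
        _ ≤ ∑ i, ∑ x ∈ B l, ((#(L x i) : ℝ) - #(L' x i)) :=
          sum_le_sum_of_subset_of_nonneg (filter_subset _ _) fun i _ _ =>
            sum_nonneg fun x _ => hdrop x i
    have htotal : η ^ (m' + n') * δ * t * #{x | IsRich r δ (L x)} ≤
        ∑ x, ∑ i, ((#(L x i) : ℝ) - #(L' x i)) := by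
      have e1 : η ^ (m' + n') * δ * t * #{x | IsRich r δ (L x)} =
          ∑ x, if IsRich r δ (L x) then η ^ (m' + n') * δ * t else 0 := by
        rw [← sum_filter, sum_const, nsmul_eq_mul, mul_comm]
      rw [e1, ← sum_fiberwise_of_maps_to (s := univ) (t := univ) (g := L) (by simp),
        ← sum_fiberwise_of_maps_to (s := univ) (t := univ) (g := L) (by simp)]
      refine sum_le_sum fun l _ => le_of_eq_of_le ?_ (hclass l)
      rw [sum_congr rfl fun x hx => by rw [(mem_filter.mp hx).2], sum_const, nsmul_eq_mul]
      split_ifs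
      · exact mul_comm _ _
      · simp
    have h2 : η ^ (m' + n') * δ ^ 2 * t * M ≤ η ^ (m' + n') * δ * t * #{x | IsRich r δ (L x)} := by
      calc η ^ (m' + n') * δ ^ 2 * t * M = η ^ (m' + n') * δ * t * (δ * M) := by ring
        _ ≤ _ := by gcongr
    rw [sum_comm] at htotal
    simp only [sum_sub_distrib] at htotal
    simp only [listSize]
    linarith

open Classical in
/-- The columns of a coloring avoiding a pattern can be given few distinct families of lists,
almost none of them rich, which contain the colors of almost all edges. -/
theorem exists_few_lists {t M s r m' n' : ℕ} (f : Fin t → Fin M → Fin s)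
    (P : Fin m' × Fin n' → Fin r) (hr : 2 ≤ r) (hs : 0 < s) (hf : ¬ ContainsPattern f P)
    (η δ : ℝ) (hη0 : 0 < η) (hη1 : η ≤ 1) (hδ : 0 < δ) (ht : 0 < t) (hM : 0 < M) (n : ℕ)
    (hn : s < n * (η ^ (m' + n') * δ ^ 2)) :
    ∃ L : Fin M → Fin t → Finset (Fin s),
      #(univ.image L) ≤ (s ^ (m' + n')) ^ n ∧
      listError f L ≤ η * s * t * M ∧
      (#{x | IsRich r δ (L x)} : ℝ) < δ * M := by
  have main : ∀ n : ℕ, ∃ L : Fin M → Fin t → Finset (Fin s),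
      #(univ.image L) ≤ (s ^ (m' + n')) ^ n ∧
      listError f L + η * listSize L ≤ η * s * t * M ∧
      ((#{x | IsRich r δ (L x)} : ℝ) < δ * M ∨
        listSize L + n * (η ^ (m' + n') * δ ^ 2) * t * M ≤ s * t * M) := by
    intro n
    induction n with
    | zero =>
      refine ⟨fun _ _ => univ, ?_, ?_, Or.inr ?_⟩
      · simpa using card_le_one.mpr (by simp)
      · simp [listError, listSize]
        apply le_of_eq; ring
      · simp [listSize]
        apply le_of_eq; ring
    | succ n ih =>
      obtain ⟨L, h1, h2, h3⟩ := ih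
      by_cases hgood : (#{x | IsRich r δ (L x)} : ℝ) < δ * M
      · exact ⟨L, h1.trans (Nat.pow_le_pow_right (by positivity) (by omega)), h2, Or.inl hgood⟩
      · obtain ⟨L', h1', h2', h3'⟩ :=
          exists_refinement f P hr hs hf η δ hη0 hη1 hδ L (not_lt.mp hgood)
        refine ⟨L', h1'.trans ?_, h2'.trans h2, Or.inr ?_⟩
        · rw [pow_succ]
          exact Nat.mul_le_mul_right _ h1
        · have := h3.resolve_left hgood
          push_cast
          linarith
  obtain ⟨L, h1, h2, h3⟩ := main n
  have hsize : 0 ≤ listSize L := sum_nonneg fun i _ => sum_nonneg fun x _ => by positivity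
  refine ⟨L, h1, by nlinarith [mul_nonneg hη0.le hsize], h3.resolve_right fun h => ?_⟩
  have h4 : (s : ℝ) * (t * M) < n * (η ^ (m' + n') * δ ^ 2) * (t * M) :=
    mul_lt_mul_of_pos_right hn (by positivity)
  linarith

/-- The second moment of a sum of functions with mean zero of independent uniform variables. -/
theorem sum_sq_sum_le {s : ℕ} (t : ℕ) (g : Fin t → Fin s → ℝ) (hg0 : ∀ i, ∑ a, g i a = 0)
    (hg1 : ∀ i a, |g i a| ≤ 1) :
    ∑ x : Fin t → Fin s, (∑ i, g i (x i)) ^ 2 ≤ t * (s : ℝ) ^ t := by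
  induction t with
  | zero => simp
  | succ t ih =>
    rw [← (Fin.consEquiv fun _ : Fin (t + 1) => Fin s).sum_comp, Fintype.sum_prod_type]
    have h1 : ∀ (a : Fin s) (y : Fin t → Fin s),
        ∑ i, g i ((Fin.consEquiv fun _ : Fin (t + 1) => Fin s) (a, y) i) =
          g 0 a + ∑ i : Fin t, g i.succ (y i) := fun a y => by
      simp [Fin.consEquiv, Fin.sum_univ_succ]
    simp only [h1, add_sq, sum_add_distrib]
    have h2 : ∑ a, ∑ y : Fin t → Fin s, 2 * g 0 a * ∑ i : Fin t, g i.succ (y i) = 0 := by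
      simp only [← mul_sum, ← sum_mul, hg0, mul_zero, zero_mul]
    have h3 : ∑ a, ∑ _y : Fin t → Fin s, g 0 a ^ 2 ≤ ∑ _a : Fin s, ∑ _y : Fin t → Fin s, (1 : ℝ) :=
      sum_le_sum fun a _ => sum_le_sum fun y _ => (sq_le_one_iff_abs_le_one _).mpr (hg1 0 a)
    have h4 := ih (fun i => g i.succ) (fun i => hg0 _) (fun i => hg1 _)
    rw [h2]
    simp only [sum_const, card_univ, Fintype.card_fin, Fintype.card_fun, nsmul_eq_mul,
      Nat.cast_pow, mul_one] at h3 ⊢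
    have h5 := mul_le_mul_of_nonneg_left h4 (Nat.cast_nonneg (α := ℝ) s)
    push_cast
    calc _ ≤ (s : ℝ) * s ^ t + 0 + s * (t * s ^ t) := by linarith
      _ = (t + 1) * s ^ (t + 1) := by ring

open Classical in
/-- Lists that are not rich have size at least `r` only in few places. -/
theorem card_filter_le_of_not_isRich {t s r : ℕ} {δ : ℝ} {l : Fin t → Finset (Fin s)}
    (hl : ¬ IsRich r δ l) :
    (#{i | r ≤ #(l i)} : ℝ) ≤ Fintype.card (Fin r ↪ Fin s) * (δ * t) := by
  have h1 : ({i | r ≤ #(l i)} : Finset (Fin t)) ⊆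
      (univ : Finset (Fin r ↪ Fin s)).biUnion fun e => {i | ∀ a, e a ∈ l i} := by
    intro i hi
    have hi' : r ≤ #(l i) := (mem_filter.mp hi).2
    obtain ⟨e⟩ : Nonempty (Fin r ↪ l i) :=
      Function.Embedding.nonempty_of_card_le (by simpa using hi')
    simp only [mem_biUnion, mem_univ, true_and, mem_filter]
    exact ⟨e.trans (Function.Embedding.subtype _), fun a => (e a).2⟩
  calc (#{i | r ≤ #(l i)} : ℝ) ≤ ∑ e : Fin r ↪ Fin s, (#{i | ∀ a, e a ∈ l i} : ℝ) := by
        exact_mod_cast (card_le_card h1).trans card_biUnion_le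
    _ ≤ ∑ _e : Fin r ↪ Fin s, δ * t := sum_le_sum fun e _ => by
        by_contra h
        exact hl ⟨e, (not_le.mp h).le⟩
    _ = _ := by simp

open Classical in
/-- The coloring whose columns are all the vectors of colors agrees with a coloring described by
few families of lists of fewer than `r` colors on a proportion of edges about `(r - 1) / s`. -/
theorem card_agree_le_s3 {t M s r : ℕ} (w : Fin M ≃ (Fin t → Fin s)) (f : Fin t → Fin M → Fin s)
    (L : Fin M → Fin t → Finset (Fin s)) (hr : 0 < r) (hs : 0 < s) (ht : 0 < t)
    (δ β K : ℝ) (hδ : 0 < δ) (hK : #(univ.image L) ≤ K)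
    (hβ : listError f L ≤ β * t * M) (hrich : (#{x | IsRich r δ (L x)} : ℝ) ≤ δ * M) :
    ∑ x, (#{i | w x i = f i x} : ℝ) ≤
      ((r - 1) / s + β + (Fintype.card (Fin r ↪ Fin s) + 2) * δ) * t * M + K * M / δ := by
  set A : ℝ := ((Fintype.card (Fin r ↪ Fin s) : ℕ) : ℝ) with hA
  have hs' : (0 : ℝ) < s := by exact_mod_cast hs
  have ht' : (0 : ℝ) < t := by exact_mod_cast ht
  let E : (Fin t → Finset (Fin s)) → Fin t → Finset (Fin s) := fun l i =>
    if #(l i) < r then l i else ∅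
  have hE : ∀ l i, (#(E l i) : ℝ) ≤ r - 1 := by
    intro l i
    have : #(E l i) + 1 ≤ r := by
      by_cases h : #(l i) < r
      · simp [E, h]
      · simp [E, h]; omega
    have : ((#(E l i) + 1 : ℕ) : ℝ) ≤ r := by exact_mod_cast this
    push_cast at this
    linarith
  let g : (Fin t → Finset (Fin s)) → Fin t → Fin s → ℝ := fun l i a =>
    (if a ∈ E l i then 1 else 0) - #(E l i) / s
  have hg0 : ∀ l i, ∑ a, g l i a = 0 := by
    intro l i
    simp only [g, sum_sub_distrib]
    simp
    field_simp
    simp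
  have hg1 : ∀ l i a, |g l i a| ≤ 1 := by
    intro l i a
    have h1 : (#(E l i) : ℝ) / s ≤ 1 := by
      rw [div_le_one hs']
      exact_mod_cast (card_le_univ (E l i)).trans_eq (by simp)
    have h2 : (0 : ℝ) ≤ #(E l i) / s := by positivity
    simp only [g]
    rw [abs_le]
    split_ifs <;> constructor <;> linarith
  have hsq : ∀ l, ∑ x, (∑ i, g l i (w x i)) ^ 2 ≤ t * M := by
    intro l
    rw [w.sum_comp fun v => (∑ i, g l i (v i)) ^ 2]
    have hM : M = s ^ t := by simpa using Fintype.card_congr w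
    rw [hM]
    exact_mod_cast sum_sq_sum_le t (g l) (hg0 l) (hg1 l)
  have hpoint : ∀ x, (#{i | w x i = f i x} : ℝ) ≤ #{i | f i x ∉ L x i} +
      (A * (δ * t) + if IsRich r δ (L x) then (t : ℝ) else 0) +
      ((r - 1) / s * t + δ * t + ∑ l ∈ univ.image L, (∑ i, g l i (w x i)) ^ 2 / (δ * t)) := by
    intro x
    have h1 : (#{i | w x i = f i x} : ℝ) ≤ #{i | f i x ∉ L x i} + #{i | r ≤ #(L x i)} +
        #{i | w x i ∈ E (L x) i} := by
      have hsub : ({i | w x i = f i x} : Finset (Fin t)) ⊆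
          (({i | f i x ∉ L x i} : Finset (Fin t)) ∪ ({i | r ≤ #(L x i)} : Finset (Fin t))) ∪
          ({i | w x i ∈ E (L x) i} : Finset (Fin t)) := by
        intro i hi
        have hi' : w x i = f i x := (mem_filter.mp hi).2
        simp only [mem_union, mem_filter, mem_univ, true_and]
        by_cases h : #(L x i) < r
        · simp only [E, if_pos h, hi']
          tauto
        · exact Or.inl (Or.inr (not_lt.mp h))
      exact_mod_cast (card_le_card hsub).trans
        ((card_union_le _ _).trans (Nat.add_le_add_right (card_union_le _ _) _))
    have h2 : (#{i | r ≤ #(L x i)} : ℝ) ≤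
        A * (δ * t) + if IsRich r δ (L x) then (t : ℝ) else 0 := by
      split_ifs with h
      · have h3 : (#{i | r ≤ #(L x i)} : ℝ) ≤ t := by
          exact_mod_cast (card_le_univ _).trans_eq (by simp)
        have : 0 ≤ A * (δ * t) := by positivity
        linarith
      · rw [add_zero]
        exact card_filter_le_of_not_isRich h
    have h3 : (#{i | w x i ∈ E (L x) i} : ℝ) =
        ∑ i, g (L x) i (w x i) + ∑ i, (#(E (L x) i) : ℝ) / s := by
      simp [g]
    have h4 : ∑ i, (#(E (L x) i) : ℝ) / s ≤ (r - 1) / s * t := by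
      calc _ ≤ ∑ _i : Fin t, ((r : ℝ) - 1) / s :=
            sum_le_sum fun i _ => div_le_div_of_nonneg_right (hE _ i) hs'.le
        _ = _ := by simp [mul_comm]
    have h5 : ∀ D : ℝ, D ≤ δ * t + D ^ 2 / (δ * t) := by
      intro D
      have hp : 0 < δ * t := by positivity
      have : D ^ 2 / (δ * t) - D + δ * t = ((D - δ * t / 2) ^ 2 + 3 / 4 * (δ * t) ^ 2) / (δ * t) := by
        field_simp
        ring
      have : 0 ≤ D ^ 2 / (δ * t) - D + δ * t := by rw [this]; positivity
      linarith
    have h6 : (∑ i, g (L x) i (w x i)) ^ 2 / (δ * t) ≤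
        ∑ l ∈ univ.image L, (∑ i, g l i (w x i)) ^ 2 / (δ * t) :=
      single_le_sum (f := fun l => (∑ i, g l i (w x i)) ^ 2 / (δ * t))
        (fun l _ => by positivity) (mem_image_of_mem L (mem_univ x))
    have := h5 (∑ i, g (L x) i (w x i))
    linarith
  have hsum := sum_le_sum fun x (_ : x ∈ univ) => hpoint x
  simp only [sum_add_distrib] at hsum
  have e1 : ∑ x, (#{i | f i x ∉ L x i} : ℝ) = listError f L := by
    simp only [listError, card_filter]
    push_cast
    exact sum_comm
  have e2 : ∑ x, (if IsRich r δ (L x) then (t : ℝ) else 0) ≤ δ * M * t := by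
    rw [← sum_filter, sum_const, nsmul_eq_mul]
    gcongr
  have e3 : ∑ x, ∑ l ∈ univ.image L, (∑ i, g l i (w x i)) ^ 2 / (δ * t) ≤ K * M / δ := by
    rw [sum_comm]
    calc _ ≤ ∑ l ∈ univ.image L, (M / δ : ℝ) := by
          refine sum_le_sum fun l _ => ?_
          rw [← sum_div]
          calc _ ≤ t * M / (δ * t) := by gcongr; exact hsq l
            _ = M / δ := by field_simp
      _ = #(univ.image L) * (M / δ) := by simp
      _ ≤ K * (M / δ) := by gcongr
      _ = _ := by ring
  rw [e1] at hsum
  simp only [sum_const, card_univ, Fintype.card_fin, nsmul_eq_mul] at hsum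
  linarith

/-- On some complete bipartite graph, some coloring is almost as far from avoiding the pattern as
a random coloring. -/
theorem exists_far_coloring {s r m' n' : ℕ} (hr : 2 ≤ r) (hs : 0 < s)
    (P : Fin m' × Fin n' → Fin r) (γ : ℝ) (hγ0 : 0 < γ) (hγ1 : γ ≤ 1) :
    ∃ t M : ℕ, 0 < t ∧ 0 < M ∧ ∃ c : Fin t → Fin M → Fin s, ∀ f : Fin t → Fin M → Fin s,
      ¬ ContainsPattern f P → ((s - r + 1) / s - γ) * (t * M) ≤ (ColDist c f : ℝ) := by
  set A : ℝ := ((Fintype.card (Fin r ↪ Fin s) : ℕ) : ℝ) with hA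
  have hA0 : 0 ≤ A := Nat.cast_nonneg _
  have hs' : (1 : ℝ) ≤ s := by exact_mod_cast hs
  set δ : ℝ := γ / (A + 4) with hδ
  have hδ0 : 0 < δ := by positivity
  have hδ1 : δ ≤ 1 := by
    rw [hδ, div_le_one (by positivity)]
    linarith
  have hη0 : 0 < δ / s := by positivity
  have hη1 : δ / s ≤ 1 := by
    rw [div_le_one (by positivity)]
    linarith
  obtain ⟨n, hn⟩ := exists_nat_gt ((s : ℝ) / ((δ / s) ^ (m' + n') * δ ^ 2))
  rw [div_lt_iff₀ (by positivity)] at hn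
  set K : ℕ := (s ^ (m' + n')) ^ n with hK
  obtain ⟨t, ht⟩ := exists_nat_gt ((K : ℝ) / δ ^ 2)
  rw [div_lt_iff₀ (by positivity)] at ht
  have ht0 : 0 < t := by
    rcases Nat.eq_zero_or_pos t with rfl | h
    · have : (0 : ℝ) ≤ K := Nat.cast_nonneg _
      simp only [Nat.cast_zero, zero_mul] at ht
      linarith
    · exact h
  have hM0 : 0 < s ^ t := by positivity
  let w : Fin (s ^ t) ≃ (Fin t → Fin s) := finFunctionFinEquiv.symm
  refine ⟨t, s ^ t, ht0, hM0, fun i x => w x i, fun f hf => ?_⟩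
  obtain ⟨L, hL1, hL2, hL3⟩ :=
    exists_few_lists f P hr hs hf (δ / s) δ hη0 hη1 hδ0 ht0 hM0 n hn
  have hagree := card_agree_le_s3 w f L (by omega) hs ht0 δ δ K hδ0 (by exact_mod_cast hL1)
    (hL2.trans_eq (by field_simp)) hL3.le
  have hcount : (ColDist (fun i x => w x i) f : ℝ) + ∑ x, (#{i | w x i = f i x} : ℝ) =
      t * (s ^ t : ℕ) := by
    have e1 : (ColDist (fun i x => w x i) f : ℝ) = ∑ x, (#{i | w x i ≠ f i x} : ℝ) := by
      simp only [ColDist, card_filter, Fintype.sum_prod_type]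
      push_cast
      exact sum_comm
    rw [e1, ← sum_add_distrib]
    have e2 : ∀ x, (#{i | w x i ≠ f i x} : ℝ) + #{i | w x i = f i x} = t := by
      intro x
      have := card_filter_add_card_filter_not (s := (univ : Finset (Fin t)))
        (fun i => w x i = f i x)
      rw [card_univ, Fintype.card_fin] at this
      rw [add_comm]
      exact_mod_cast this
    simp only [e2, sum_const, card_univ, Fintype.card_fin, nsmul_eq_mul]
    ring
  set M : ℝ := ((s ^ t : ℕ) : ℝ) with hM
  have hM' : 0 < M := by
    rw [hM]
    exact_mod_cast hM0
  have hKt : (K : ℝ) * M / δ ≤ δ * t * M := by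
    rw [div_le_iff₀ hδ0]
    nlinarith
  have hγ : γ = (A + 4) * δ := by
    rw [hδ]
    field_simp
  have hsr : ((s : ℝ) - r + 1) / s = 1 - (r - 1) / s := by
    field_simp
    ring
  rw [hsr, hγ]
  linarith

/-- Far colorings of a small complete bipartite graph tile far colorings of larger ones. -/
theorem exists_far_tiling {s r m' n' t M : ℕ} (ht : 0 < t) (hM : 0 < M)
    (P : Fin m' × Fin n' → Fin r) (c : Fin t → Fin M → Fin s) (D : ℝ)
    (hc : ∀ f : Fin t → Fin M → Fin s, ¬ ContainsPattern f P → D ≤ ColDist c f) (m n : ℕ) :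
    ∃ c₁ : Fin m → Fin n → Fin s, ∀ c' : Fin m → Fin n → Fin s, ¬ ContainsPattern c' P →
      (m / t : ℕ) * (n / M : ℕ) * D ≤ (ColDist c₁ c' : ℝ) := by
  refine ⟨fun i j => c ⟨i % t, Nat.mod_lt _ ht⟩ ⟨j % M, Nat.mod_lt _ hM⟩, fun c' hc' => ?_⟩
  have hlt : ∀ (l k : ℕ) (a : Fin (l / k)) (i : Fin k), i + k * a < l := by
    intro l k a i
    have h1 : k * (a + 1) ≤ k * (l / k) := Nat.mul_le_mul_left _ a.2
    have h2 := Nat.mul_div_le l k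
    have h3 := i.2
    rw [Nat.mul_add] at h1
    omega
  let emb : ∀ l k : ℕ, Fin (l / k) → Fin k → Fin l := fun l k a i => ⟨i + k * a, hlt l k a i⟩
  have hmod : ∀ l k a i, (emb l k a i : ℕ) % k = i := by
    intro l k a i
    simp [emb, Nat.mod_eq_of_lt i.2]
  have hdiv : ∀ l k a i, (emb l k a i : ℕ) / k = a := by
    intro l k a i
    have : 0 < k := i.pos
    simp [emb, Nat.add_mul_div_left _ _ this, Nat.div_eq_of_lt i.2]
  have hinj : ∀ l k a a' i i', emb l k a i = emb l k a' i' → a = a' ∧ i = i' := by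
    intro l k a a' i i' h
    constructor
    · exact Fin.ext (by rw [← hdiv l k a i, h, hdiv])
    · exact Fin.ext (by rw [← hmod l k a i, h, hmod])
  let sub : Fin (m / t) × Fin (n / M) → Fin t → Fin M → Fin s := fun ab i j =>
    c' (emb m t ab.1 i) (emb n M ab.2 j)
  have hsub : ∀ ab, ¬ ContainsPattern (sub ab) P := by
    rintro ab ⟨φ, ψ, h⟩
    exact hc' ⟨⟨fun i => emb m t ab.1 (φ i), fun i i' hi => φ.injective (hinj _ _ _ _ _ _ hi).2⟩,
      ⟨fun j => emb n M ab.2 (ψ j), fun j j' hj => ψ.injective (hinj _ _ _ _ _ _ hj).2⟩, h⟩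
  have hcard : ∑ ab, ColDist c (sub ab) ≤ ColDist (fun (i : Fin m) (j : Fin n) =>
      c ⟨i % t, Nat.mod_lt _ ht⟩ ⟨j % M, Nat.mod_lt _ hM⟩) c' := by
    simp only [ColDist]
    rw [← card_sigma]
    refine card_le_card_of_injOn
      (fun p => (emb m t p.1.1 p.2.1, emb n M p.1.2 p.2.2)) ?_ ?_
    · intro p hp
      simpa [hmod, sub] using hp
    · rintro ⟨⟨a, b⟩, i, j⟩ - ⟨⟨a', b'⟩, i', j'⟩ - h
      obtain ⟨rfl, rfl⟩ := hinj _ _ _ _ _ _ (congrArg Prod.fst h)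
      obtain ⟨rfl, rfl⟩ := hinj _ _ _ _ _ _ (congrArg Prod.snd h)
      rfl
  calc ((m / t : ℕ) : ℝ) * (n / M : ℕ) * D = ∑ _ab : Fin (m / t) × Fin (n / M), D := by simp
    _ ≤ ∑ ab, (ColDist c (sub ab) : ℝ) := sum_le_sum fun ab _ => hc _ (hsub ab)
    _ ≤ _ := by exact_mod_cast hcard

/-- **Lower bound of Theorem 1.2.**  Let `0 < ε < 1`, let `s ≥ r ≥ 2`, `m'`, `n'` be fixed
positive integers, and let `P` be a pattern with `r` nonempty color classes on `K_{m',n'}`.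
Then for all `m, n` with `m + n` sufficiently large,
`F(m,n; s, P) ≥ (1 - ε (5s + 2 + (s+1)(m/n + n/m))) ((s-r+1)/s) mn`:
there is an `s`-coloring `c` of `K_{m,n}` such that every `P`-occurrence-free `s`-coloring
differs from `c` on at least that many edges. -/
theorem coloring_editing_lower_bound
    (ε : ℝ) (hε0 : 0 < ε) (hε1 : ε < 1)
    (s r m' n' : ℕ) (hr : 2 ≤ r) (hrs : r ≤ s) (hm' : 0 < m') (hn' : 0 < n')
    (P : Fin m' × Fin n' → Fin r) (hP : Function.Surjective P) :
    ∃ N : ℕ, ∀ m n : ℕ, 0 < m → 0 < n → N ≤ m + n →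
      ∃ c : Fin m → Fin n → Fin s, ∀ c' : Fin m → Fin n → Fin s,
        ¬ ContainsPattern c' P →
        (1 - ε * (5 * s + 2 + (s + 1) * ((m : ℝ) / n + (n : ℝ) / m))) *
            (((s : ℝ) - r + 1) / s) * m * n ≤ (ColDist c c' : ℝ) := by
  have hs0 : 0 < s := by omega
  have hsR : (1 : ℝ) ≤ s := by exact_mod_cast hs0
  have hrsR : (r : ℝ) ≤ s := by exact_mod_cast hrs
  have hrR : (2 : ℝ) ≤ r := by exact_mod_cast hr
  set u : ℝ := ((s : ℝ) - r + 1) / s with hu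
  have hu0 : 0 < u := div_pos (by linarith) (by linarith)
  have hu1 : u ≤ 1 := by
    rw [hu, div_le_one (by linarith)]
    linarith
  obtain ⟨t, M, ht, hM, c, hc⟩ :=
    exists_far_coloring hr hs0 P (ε * u) (by positivity) (by nlinarith)
  obtain ⟨N, hN⟩ := exists_nat_ge ((t + M) / ε + (t + M) / ε ^ 2 : ℝ)
  refine ⟨N, fun m n hm hn hmn => ?_⟩
  obtain ⟨c₁, hc₁⟩ := exists_far_tiling ht hM P c _ hc m n
  refine ⟨c₁, fun c' hc' => le_trans ?_ (hc₁ c' hc')⟩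
  have htR : (0 : ℝ) < t := by exact_mod_cast ht
  have hMR : (0 : ℝ) < M := by exact_mod_cast hM
  have hmR : (0 : ℝ) < m := by exact_mod_cast hm
  have hnR : (0 : ℝ) < n := by exact_mod_cast hn
  have hmnR : (t + M) / ε + (t + M) / ε ^ 2 ≤ (m + n : ℝ) := hN.trans (by exact_mod_cast hmn)
  have hq1 : 0 < (m : ℝ) / n := by positivity
  have hq2 : 0 < (n : ℝ) / m := by positivity
  have hRHS : 0 ≤ ((m / t : ℕ) : ℝ) * (n / M : ℕ) * ((u - ε * u) * (t * M)) := by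
    have : 0 ≤ u - ε * u := by nlinarith
    positivity
  have hsmall : ∀ a b : ℝ, 0 < a → (t + M) / ε + (t + M) / ε ^ 2 ≤ a + b → a < (t + M) / ε →
      1 ≤ ε * (b / a) := by
    intro a b ha hab hlt
    have h1 : (t + M) / ε ^ 2 ≤ b := by linarith
    have h2 : ((t : ℝ) + M) / ε ^ 2 * ε = (t + M) / ε := by field_simp
    rw [← mul_div_assoc, le_div_iff₀ ha]
    nlinarith
  have htriv : 1 ≤ ε * ((m : ℝ) / n + (n : ℝ) / m) →
      (1 - ε * (5 * s + 2 + (s + 1) * ((m : ℝ) / n + (n : ℝ) / m))) * u * m * n ≤ 0 := by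
    intro h
    have h1 : 1 - ε * (5 * s + 2 + (s + 1) * ((m : ℝ) / n + (n : ℝ) / m)) ≤ 0 := by
      have h2 : 0 < ε * (5 * s + 2) := by positivity
      have h3 : 0 < ε * (s * ((m : ℝ) / n + (n : ℝ) / m)) := by positivity
      linarith
    have h4 : 0 ≤ u * m * n := by positivity
    calc _ = (1 - ε * (5 * s + 2 + (s + 1) * ((m : ℝ) / n + (n : ℝ) / m))) * (u * m * n) := by ring
      _ ≤ 0 := mul_nonpos_of_nonpos_of_nonneg h1 h4
  rcases lt_or_ge (m : ℝ) ((t + M) / ε) with hm1 | hm1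
  · refine (htriv ?_).trans hRHS
    have := hsmall m n hmR hmnR hm1
    have := mul_pos hε0 hq1
    linarith
  rcases lt_or_ge (n : ℝ) ((t + M) / ε) with hn1 | hn1
  · refine (htriv ?_).trans hRHS
    have := hsmall n m hnR (by linarith) hn1
    have := mul_pos hε0 hq2
    linarith
  rw [div_le_iff₀ hε0] at hm1 hn1
  have hfloor : ∀ a k : ℕ, 0 < k → (a : ℝ) - k ≤ (a / k : ℕ) * k := by
    intro a k hk
    have h1 := Nat.div_add_mod a k
    have h2 := Nat.mod_lt a hk
    have h3 : a ≤ a / k * k + k := by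
      rw [Nat.mul_comm]
      omega
    have : ((a : ℕ) : ℝ) ≤ (a / k * k + k : ℕ) := by exact_mod_cast h3
    push_cast at this
    linarith
  have hmt : (1 - ε) * m ≤ (m / t : ℕ) * t := by linarith [hfloor m t ht]
  have hnM : (1 - ε) * n ≤ (n / M : ℕ) * M := by linarith [hfloor n M hM]
  have hε' : 0 ≤ 1 - ε := by linarith
  calc (1 - ε * (5 * s + 2 + (s + 1) * ((m : ℝ) / n + (n : ℝ) / m))) * u * m * n
      = (1 - ε * (5 * s + 2 + (s + 1) * ((m : ℝ) / n + (n : ℝ) / m))) * (u * m * n) := by ring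
    _ ≤ (1 - ε) ^ 3 * (u * m * n) := by
      refine mul_le_mul_of_nonneg_right ?_ (by positivity)
      have h1 : 0 < ε * ((s + 1) * ((m : ℝ) / n + (n : ℝ) / m)) := by positivity
      nlinarith [mul_pos hε0 hε0, mul_nonneg (mul_pos hε0 hε0).le hε']
    _ = ((1 - ε) * m) * ((1 - ε) * n) * (u - ε * u) := by ring
    _ ≤ ((m / t : ℕ) * t) * ((n / M : ℕ) * M) * (u - ε * u) := by
      have h1 : 0 ≤ u - ε * u := by nlinarith
      gcongr
    _ = _ := by ring
end
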